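/- arXiv:1811.01696 — 3 statements merged into one kernel-verified Lean document; each statement's English description precedes it below -/
import Mathlib

section
/- Let n ≥ 2, let M be a matroid on [n], and let k be a positive integer with k < n. Then I_k(M)² ≥ ((k+1)/k)·((n−k+1)/(n−k))·I_{k−1}(M)·I_{k+1}(M), where I_j(M) denotes the number of j-element independent sets of M. Equivalently, I_k(M)²/C(n,k)² ≥ (I_{k+1}(M)/C(n,k+1))·(I_{k−1}(M)/C(n,k−1)). -/
open Finset

/-- Rank-function axioms for a matroid on `[n]` (Oxley, Theorem 1.3.2).
A set `A` is independent if and only if `rk A = A.card`. -/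
def IsMatroidRank (n : ℕ) (rk : Finset (Fin n) → ℕ) : Prop :=
  (∀ A, rk A ≤ A.card) ∧
  (∀ A B, A ⊆ B → rk A ≤ rk B) ∧
  (∀ A B : Finset (Fin n), rk (A ∪ B) + rk (A ∩ B) ≤ rk A + rk B)

/-- `f^m_M(w)`, the `m`-th generating function of the matroid: the sum over all
independent sets of size `m` of the corresponding squarefree monomials. -/
noncomputable def fm (n : ℕ) (rk : Finset (Fin n) → ℕ) (m : ℕ) (w : Fin n → ℝ) : ℝ :=
  ∑ A ∈ (Finset.powersetCard m (Finset.univ : Finset (Fin n))).filter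
      (fun A => rk A = A.card), ∏ i ∈ A, w i

/-- `I_k(M)`, the number of `k`-element independent sets of the matroid. -/
def Ik (n : ℕ) (rk : Finset (Fin n) → ℕ) (k : ℕ) : ℕ :=
  ((Finset.powersetCard k (Finset.univ : Finset (Fin n))).filter
    (fun A => rk A = A.card)).card

open Matrix in
theorem quadForm_nonpos_of_eigenvector {ι : Type*} [Fintype ι] [DecidableEq ι]
    {B : Matrix ι ι ℝ} (hB : B.IsSymm) (u : ι → ℝ)
    (h : ∀ (l : ℝ) (b : ι → ℝ), 0 < l → B *ᵥ b = l • b → b ⬝ᵥ u = 0) :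
    u ⬝ᵥ B *ᵥ u ≤ 0 := by
  have hH : B.IsHermitian := by
    rw [Matrix.IsHermitian, conjTranspose_eq_transpose_of_trivial]; exact hB
  have key := hH.eigenvectorBasis.sum_inner_mul_inner (WithLp.toLp 2 u) (WithLp.toLp 2 (B *ᵥ u))
  have e : inner ℝ (WithLp.toLp 2 u) (WithLp.toLp 2 (B *ᵥ u)) = u ⬝ᵥ B *ᵥ u := by
    simp [EuclideanSpace.inner_eq_star_dotProduct, dotProduct_comm]
  rw [← e, ← key]
  refine Finset.sum_nonpos fun i _ => ?_
  have hb := hH.mulVec_eigenvectorBasis i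
  set b := (hH.eigenvectorBasis i).ofLp with hbdef
  have h1 : inner ℝ (WithLp.toLp 2 u) (hH.eigenvectorBasis i) = b ⬝ᵥ u := by
    simp [EuclideanSpace.inner_eq_star_dotProduct, hbdef]
  have h2 : inner ℝ (hH.eigenvectorBasis i) (WithLp.toLp 2 (B *ᵥ u))
      = hH.eigenvalues i * (b ⬝ᵥ u) := by
    have : b ⬝ᵥ (B *ᵥ u) = (B *ᵥ b) ⬝ᵥ u := by
      rw [dotProduct_mulVec, ← mulVec_transpose, hB.eq]
    rw [← smul_eq_mul, ← smul_dotProduct, ← hb, ← this]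
    simp [EuclideanSpace.inner_eq_star_dotProduct, hbdef, dotProduct_comm]
  rw [h1, h2]
  rcases le_or_gt (hH.eigenvalues i) 0 with hl | hl
  · nlinarith [mul_nonneg (neg_nonneg.2 hl) (sq_nonneg (b ⬝ᵥ u))]
  · rw [h _ b hl hb]; simp

open Matrix in
/-- The reverse Cauchy-Schwarz inequality for a symmetric form that is nonpositive on a hyperplane. -/
theorem mul_quadForm_le_sq {ι : Type*} [Fintype ι] {H : Matrix ι ι ℝ}
    (hH : H.IsSymm) (l : ι → ℝ) (hl : ∀ v, l ⬝ᵥ v = 0 → v ⬝ᵥ H *ᵥ v ≤ 0)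
    (u : ι → ℝ) (hu : 0 ≤ u ⬝ᵥ H *ᵥ u) (v : ι → ℝ) :
    (u ⬝ᵥ H *ᵥ u) * (v ⬝ᵥ H *ᵥ v) ≤ (v ⬝ᵥ H *ᵥ u) ^ 2 := by
  rcases le_or_gt ((u ⬝ᵥ H *ᵥ u) * (v ⬝ᵥ H *ᵥ v)) 0 with h | h
  · exact h.trans (sq_nonneg _)
  have hu' : 0 < u ⬝ᵥ H *ᵥ u := lt_of_le_of_ne hu fun h0 => by simp [← h0] at h
  have hv' : 0 < v ⬝ᵥ H *ᵥ v := pos_of_mul_pos_right h hu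
  have lu : l ⬝ᵥ u ≠ 0 := fun h0 => absurd (hl u h0) (not_le.2 hu')
  have lv : l ⬝ᵥ v ≠ 0 := fun h0 => absurd (hl v h0) (not_le.2 hv')
  have hsymm : u ⬝ᵥ H *ᵥ v = v ⬝ᵥ H *ᵥ u := by
    rw [dotProduct_mulVec, ← mulVec_transpose, hH.eq, dotProduct_comm]
  have hz := hl ((l ⬝ᵥ v) • u - (l ⬝ᵥ u) • v) (by
    simp only [dotProduct_sub, dotProduct_smul, smul_eq_mul]; ring)
  simp only [mulVec_sub, mulVec_smul, dotProduct_sub, sub_dotProduct, dotProduct_smul,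
    smul_dotProduct, smul_eq_mul, hsymm] at hz
  set a := l ⬝ᵥ u
  set b := l ⬝ᵥ v
  set q := u ⬝ᵥ H *ᵥ u
  set r := v ⬝ᵥ H *ᵥ v
  set p := v ⬝ᵥ H *ᵥ u
  have hab : 0 < (a * b) ^ 2 := by positivity
  have h1 : b ^ 2 * q + a ^ 2 * r ≤ 2 * (a * b * p) := by linarith
  have h2 : 0 ≤ b ^ 2 * q + a ^ 2 * r := by positivity
  have h3 : (b ^ 2 * q + a ^ 2 * r) ^ 2 ≤ (2 * (a * b * p)) ^ 2 := pow_le_pow_left₀ h2 h1 2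
  refine le_of_mul_le_mul_left ?_ hab
  nlinarith [sq_nonneg (b ^ 2 * q - a ^ 2 * r)]

open Matrix in
/-- A solution of `H v = l D v` with `1 ≤ l` and `H w ≤ D w` is proportional to the positive vector
`w` outside the zero rows of `H`, provided all nonzero rows are adjacent to the hub `o`. -/
theorem exists_eq_mul_of_one_le_eigenvalue {ι : Type*} [Fintype ι] {H : Matrix ι ι ℝ}
    (hH : H.IsSymm) (hnonneg : ∀ i j, 0 ≤ H i j) {w : ι → ℝ} (hw : ∀ i, 0 < w i) {o : ι}
    (hub : ∀ i, 0 < H o i ∨ ∀ j, H i j = 0) {D : ι → ℝ} (hD : ∀ i, 0 < D i)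
    (hDw : ∀ i, (H *ᵥ w) i ≤ D i * w i) {l : ℝ} (hl : 1 ≤ l) {v : ι → ℝ}
    (hv : ∀ i, (H *ᵥ v) i = l * (D i * v i)) :
    ∃ c, ∀ i, v i = c * w i ∨ ∀ j, H i j = 0 := by
  refine ⟨v o / w o, fun i => (hub i).imp (fun hoi => ?_) id⟩
  have hexp : ∑ i, ∑ j, H i j * w i * w j * (v i / w i - v j / w j) ^ 2
      = 2 * ∑ i, (H *ᵥ w) i / w i * v i ^ 2 - 2 * ∑ i, v i * (H *ᵥ v) i := by
    have e1 : ∀ i j, H i j * w i * w j * (v i / w i - v j / w j) ^ 2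
        = H i j * w j / w i * v i ^ 2 + H j i * w i / w j * v j ^ 2 - 2 * (v i * (H i j * v j)) := by
      intro i j
      have := (hw i).ne'; have := (hw j).ne'
      rw [hH.apply i j]
      field_simp
      ring
    simp only [e1, Finset.sum_sub_distrib, Finset.sum_add_distrib]
    rw [Finset.sum_comm (f := fun i j => H j i * w i / w j * v j ^ 2)]
    rw [two_mul]
    simp only [mulVec, dotProduct, Finset.mul_sum, Finset.sum_div, Finset.sum_mul]
  have hle : ∑ i, ∑ j, H i j * w i * w j * (v i / w i - v j / w j) ^ 2 ≤ 0 := by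
    rw [hexp, ← mul_sub, ← Finset.sum_sub_distrib]
    refine mul_nonpos_of_nonneg_of_nonpos zero_le_two (Finset.sum_nonpos fun i _ => ?_)
    have h1 : (H *ᵥ w) i / w i ≤ D i := (div_le_iff₀ (hw i)).2 (hDw i)
    rw [hv i]
    have h2 := mul_le_mul_of_nonneg_right h1 (sq_nonneg (v i))
    have h3 : 0 ≤ (l - 1) * (D i * v i ^ 2) :=
      mul_nonneg (by linarith) (mul_nonneg (hD i).le (sq_nonneg _))
    nlinarith
  have hterm : ∀ i j, 0 ≤ H i j * w i * w j * (v i / w i - v j / w j) ^ 2 := fun i j =>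
    mul_nonneg (mul_nonneg (mul_nonneg (hnonneg i j) (hw i).le) (hw j).le) (sq_nonneg _)
  have h0 := (Finset.sum_eq_zero_iff_of_nonneg fun i _ => Finset.sum_nonneg fun j _ => hterm i j).1
    (le_antisymm hle (Finset.sum_nonneg fun i _ => Finset.sum_nonneg fun j _ => hterm i j)) o
    (Finset.mem_univ _)
  have h1 := (Finset.sum_eq_zero_iff_of_nonneg fun j _ => hterm o j).1 h0 i (Finset.mem_univ _)
  have h2 : H o i * w o * w i ≠ 0 := (mul_pos (mul_pos hoi (hw o)) (hw i)).ne'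
  have h3 := pow_eq_zero_iff two_ne_zero |>.1 ((mul_eq_zero.1 h1).resolve_left h2)
  rw [sub_eq_zero.1 h3, div_mul_cancel₀ _ (hw i).ne']

open Matrix in
/-- Local-to-global principle: if all slices of a symmetric nonnegative tensor are nonpositive on a
hyperplane, then so is their weighted sum, provided it has a connected support. -/
theorem quadForm_nonpos_of_slices {ι : Type*} [Fintype ι] [DecidableEq ι] {H : Matrix ι ι ℝ}
    {T : ι → Matrix ι ι ℝ} (hH : H.IsSymm) (hHnonneg : ∀ i j, 0 ≤ H i j)
    (hT : ∀ k, (T k).IsSymm) (hTnonneg : ∀ k i j, 0 ≤ T k i j) {w : ι → ℝ} (hw : ∀ i, 0 < w i)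
    {c : ℝ} (hc : 0 < c) (hsum : ∀ i j, ∑ k, w k * T k i j = c * H i j)
    (hslice : ∀ k i, (T k *ᵥ w) i = c * H k i) {o : ι}
    (hub : ∀ i, 0 < H o i ∨ ∀ j, H i j = 0)
    (hneg : ∀ k, ∃ l : ι → ℝ, ∀ v, l ⬝ᵥ v = 0 → v ⬝ᵥ T k *ᵥ v ≤ 0)
    (x : ι → ℝ) (hx : (H *ᵥ w) ⬝ᵥ x = 0) : x ⬝ᵥ H *ᵥ x ≤ 0 := by
  have hHw : ∀ i, 0 ≤ (H *ᵥ w) i := fun i =>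
    Finset.sum_nonneg fun j _ => mul_nonneg (hHnonneg i j) (hw j).le
  have hrow : ∀ i, (H *ᵥ w) i = 0 → ∀ j, H i j = 0 := fun i hi j => by
    have := (Finset.sum_eq_zero_iff_of_nonneg fun j _ =>
      mul_nonneg (hHnonneg i j) (hw j).le).1 hi j (Finset.mem_univ _)
    exact (mul_eq_zero.1 this).resolve_right (hw j).ne'
  have hTrow : ∀ k, (H *ᵥ w) k = 0 → T k = 0 := fun k hk => by
    ext i j
    have h0 : (T k *ᵥ w) i = 0 := by rw [hslice, hrow k hk, mul_zero]
    have := (Finset.sum_eq_zero_iff_of_nonneg fun j _ =>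
      mul_nonneg (hTnonneg k i j) (hw j).le).1 h0 j (Finset.mem_univ _)
    exact (mul_eq_zero.1 this).resolve_right (hw j).ne'
  set D : ι → ℝ := fun i => if (H *ᵥ w) i = 0 then 1 else (H *ᵥ w) i / w i with hDdef
  have hD : ∀ i, 0 < D i := fun i => by
    by_cases h : (H *ᵥ w) i = 0
    · simp [hDdef, h]
    · simp only [hDdef, h, if_false]
      exact div_pos (lt_of_le_of_ne (hHw i) (Ne.symm h)) (hw i)
  have hDw : ∀ i, (H *ᵥ w) i ≤ D i * w i := fun i => by
    by_cases h : (H *ᵥ w) i = 0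
    · simp [hDdef, h, (hw i).le]
    · simp only [hDdef, h, if_false]
      rw [div_mul_cancel₀ _ (hw i).ne']
  have hbound : ∀ v, v ⬝ᵥ H *ᵥ v ≤ ∑ k, (H *ᵥ v) k ^ 2 / D k := fun v => by
    have hterm : ∀ k, w k * (v ⬝ᵥ T k *ᵥ v) ≤ c * ((H *ᵥ v) k ^ 2 / D k) := fun k => by
      by_cases h : (H *ᵥ w) k = 0
      · rw [hTrow k h]
        simp only [zero_mulVec, dotProduct_zero, mul_zero]
        exact mul_nonneg hc.le (div_nonneg (sq_nonneg _) (hD k).le)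
      · have hpos : 0 < (H *ᵥ w) k := lt_of_le_of_ne (hHw k) (Ne.symm h)
        have e1 : ∀ u, u ⬝ᵥ T k *ᵥ w = c * (H *ᵥ u) k := fun u => by
          change ∑ i, u i * (T k *ᵥ w) i = c * ∑ i, H k i * u i
          rw [Finset.mul_sum]
          exact Finset.sum_congr rfl fun i _ => by rw [hslice]; ring
        obtain ⟨l, hl⟩ := hneg k
        have h1 := mul_quadForm_le_sq (hT k) l hl w (by rw [e1]; positivity) v
        rw [e1, e1] at h1
        simp only [hDdef, h, if_false]
        have hwk := hw k
        rw [div_div_eq_mul_div, ← mul_div_assoc, le_div_iff₀ hpos]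
        refine le_of_mul_le_mul_left ?_ hc
        nlinarith
    have hs : ∑ k, w k * (v ⬝ᵥ T k *ᵥ v) = c * (v ⬝ᵥ H *ᵥ v) := by
      simp only [dotProduct, mulVec, Finset.mul_sum]
      rw [Finset.sum_comm]
      refine Finset.sum_congr rfl fun i _ => ?_
      rw [Finset.sum_comm]
      refine Finset.sum_congr rfl fun j _ => ?_
      rw [show c * (v i * (H i j * v j)) = (c * H i j) * (v i * v j) by ring, ← hsum,
        Finset.sum_mul]
      exact Finset.sum_congr rfl fun k _ => by ring
    refine le_of_mul_le_mul_left ?_ hc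
    rw [← hs, Finset.mul_sum]
    exact Finset.sum_le_sum fun k _ => hterm k
  set s : ι → ℝ := fun i => √(D i) with hsdef
  have hs : ∀ i, 0 < s i := fun i => Real.sqrt_pos.2 (hD i)
  have hss : ∀ i, s i * s i = D i := fun i => Real.mul_self_sqrt (hD i).le
  set B : Matrix ι ι ℝ := Matrix.of fun i j => H i j / (s i * s j) with hBdef
  have hB : B.IsSymm := by
    ext i j
    simp only [hBdef, transpose_apply, of_apply, hH.apply i j, mul_comm]
  have hquad : x ⬝ᵥ H *ᵥ x = (fun i => s i * x i) ⬝ᵥ B *ᵥ (fun i => s i * x i) := by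
    simp only [dotProduct, mulVec, Finset.mul_sum, hBdef, of_apply]
    refine Finset.sum_congr rfl fun i _ => Finset.sum_congr rfl fun j _ => ?_
    have := (hs i).ne'; have := (hs j).ne'
    field_simp
  rw [hquad]
  refine quadForm_nonpos_of_eigenvector hB _ fun l b hl hb => ?_
  set v : ι → ℝ := fun i => b i / s i with hvdef
  have hv : ∀ i, (H *ᵥ v) i = l * (D i * v i) := fun i => by
    have h1 : s i * (B *ᵥ b) i = (H *ᵥ v) i := by
      simp only [dotProduct, mulVec, Finset.mul_sum, hBdef, of_apply, hvdef]
      refine Finset.sum_congr rfl fun j _ => ?_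
      have := (hs i).ne'; have := (hs j).ne'
      field_simp
    rw [← h1, hb, ← hss, Pi.smul_apply, smul_eq_mul, hvdef]
    have := (hs i).ne'
    field_simp
  have hbx : b ⬝ᵥ (fun i => s i * x i) = ∑ i, D i * v i * x i := by
    refine Finset.sum_congr rfl fun i _ => ?_
    have := (hs i).ne'
    simp only [← hss, hvdef]
    field_simp
  rw [hbx]
  by_cases hv0 : v = 0
  · simp [hv0]
  have hl1 : 1 ≤ l := by
    have hE : 0 < ∑ i, D i * v i ^ 2 := by
      obtain ⟨i, hi⟩ := Function.ne_iff.1 hv0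
      refine Finset.sum_pos' (fun i _ => mul_nonneg (hD i).le (sq_nonneg _))
        ⟨i, Finset.mem_univ _, mul_pos (hD i) (sq_pos_of_ne_zero hi)⟩
    have h1 := hbound v
    have e1 : v ⬝ᵥ H *ᵥ v = l * ∑ i, D i * v i ^ 2 := by
      rw [Finset.mul_sum]
      exact Finset.sum_congr rfl fun i _ => by rw [hv]; ring
    have e2 : ∑ k, (H *ᵥ v) k ^ 2 / D k = l * (l * ∑ i, D i * v i ^ 2) := by
      rw [Finset.mul_sum, Finset.mul_sum]
      refine Finset.sum_congr rfl fun i _ => ?_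
      have := (hD i).ne'
      rw [hv]; field_simp
    rw [e1, e2] at h1
    have h2 := le_of_mul_le_mul_left h1 hl
    nlinarith
  obtain ⟨a, ha⟩ := exists_eq_mul_of_one_le_eigenvalue hH hHnonneg hw hub hD hDw hl1 hv
  refine (mul_eq_zero.1 (?_ : l * _ = 0)).resolve_left hl.ne'
  calc l * ∑ i, D i * v i * x i = (H *ᵥ v) ⬝ᵥ x := by
        rw [Finset.mul_sum]
        exact Finset.sum_congr rfl fun i _ => by rw [hv]; ring
    _ = v ⬝ᵥ H *ᵥ x := by
        rw [dotProduct_mulVec, ← mulVec_transpose, hH.eq]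
    _ = a * (w ⬝ᵥ H *ᵥ x) := by
        simp only [dotProduct, Finset.mul_sum (s := Finset.univ) (a := a)]
        refine Finset.sum_congr rfl fun i _ => ?_
        rcases ha i with h | h
        · rw [h]; ring
        · simp [mulVec, dotProduct, h]
    _ = 0 := by
        rw [dotProduct_mulVec, ← mulVec_transpose, hH.eq, hx, mul_zero]

theorem sq_sum_le_card_mul_sum_fiber {ι κ : Type*} [DecidableEq κ] (s : Finset ι) (f : ι → κ)
    (x : ι → ℝ) :
    (∑ i ∈ s, x i) ^ 2 ≤ #s * ∑ i ∈ s, ∑ j ∈ s, if f i = f j then x i * x j else 0 := by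
  have hmaps : ∀ i ∈ s, f i ∈ s.image f := fun i hi => mem_image_of_mem f hi
  have h1 : ∑ i ∈ s, ∑ j ∈ s, (if f i = f j then x i * x j else 0)
      = ∑ c ∈ s.image f, (∑ i ∈ s with f i = c, x i) ^ 2 := by
    rw [← sum_fiberwise_of_maps_to hmaps]
    refine sum_congr rfl fun c _ => ?_
    rw [sq, sum_mul_sum]
    refine sum_congr rfl fun i hi => ?_
    rw [(mem_filter.1 hi).2, sum_filter]
    exact sum_congr rfl fun j _ => by simp only [eq_comm]
  rw [h1, ← sum_fiberwise_of_maps_to hmaps x]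
  refine sq_sum_le_card_mul_sum_sq.trans ?_
  gcongr
  exact card_image_le

/-- The value at `w` of the partial derivative indexed by the multiset `m` of the polynomial
`∑ A ∈ s, coef A * ∏ i, X i ^ a A i`. -/
noncomputable def derivEval {ι κ : Type*} [Fintype ι] [DecidableEq ι] (s : Finset κ) (coef : κ → ℝ)
    (a : κ → ι → ℕ) (w : ι → ℝ) (m : Multiset ι) : ℝ :=
  ∑ A ∈ s, coef A * ∏ i, ((a A i).descFactorial (m.count i) * w i ^ (a A i - m.count i) : ℝ)

section DerivEval

variable {ι κ : Type*} [Fintype ι] [DecidableEq ι] {s : Finset κ} {coef : κ → ℝ} {a : κ → ι → ℕ}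
  {w : ι → ℝ} {d : ℕ}

theorem mul_descFactorial_succ_mul_pow (n c : ℕ) (x : ℝ) :
    x * (n.descFactorial (c + 1) * x ^ (n - (c + 1))) = (n - c) * (n.descFactorial c * x ^ (n - c)) := by
  rcases lt_trichotomy n c with h | rfl | h
  · rw [Nat.descFactorial_of_lt h, Nat.descFactorial_of_lt (h.trans (Nat.lt_succ_self c))]
    simp
  · rw [Nat.descFactorial_of_lt (Nat.lt_succ_self n)]
    simp
  · rw [Nat.descFactorial_succ, show n - c = n - (c + 1) + 1 by omega, pow_succ]
    have : ((n - (c + 1) + 1 : ℕ) : ℝ) = n - c := by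
      rw [show n - (c + 1) + 1 = n - c by omega, Nat.cast_sub h.le]
    rw [Nat.cast_mul, this]
    ring

/-- Euler's identity for the partial derivatives of a homogeneous polynomial. -/
theorem sum_mul_derivEval_cons (hd : ∀ A ∈ s, ∑ i, a A i = d) (m : Multiset ι) :
    ∑ i, w i * derivEval s coef a w (i ::ₘ m) = (d - m.card) * derivEval s coef a w m := by
  simp only [derivEval, mul_sum]
  rw [sum_comm]
  refine sum_congr rfl fun A hA => ?_
  set g : ι → ℝ := fun i => (a A i).descFactorial (m.count i) * w i ^ (a A i - m.count i)
  have h1 : ∀ i, w i * (coef A * ∏ j, ((a A j).descFactorial ((i ::ₘ m).count j) *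
      w j ^ (a A j - (i ::ₘ m).count j) : ℝ)) = (a A i - m.count i) * (coef A * ∏ j, g j) := by
    intro i
    rw [← mul_prod_erase univ _ (mem_univ i), ← mul_prod_erase univ g (mem_univ i)]
    have h2 : ∏ j ∈ univ.erase i, ((a A j).descFactorial ((i ::ₘ m).count j) *
        w j ^ (a A j - (i ::ₘ m).count j) : ℝ) = ∏ j ∈ univ.erase i, g j :=
      prod_congr rfl fun j hj => by rw [Multiset.count_cons_of_ne (ne_of_mem_erase hj)]
    rw [h2, Multiset.count_cons_self]
    have h3 := mul_descFactorial_succ_mul_pow (a A i) (m.count i) (w i)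
    linear_combination (coef A * ∏ j ∈ univ.erase i, g j) * h3
  rw [sum_congr rfl fun i _ => h1 i, ← sum_mul, sum_sub_distrib]
  congr 2
  · rw [← hd A hA, Nat.cast_sum]
  · rw [← Nat.cast_sum, Multiset.sum_count_eq_card fun i _ => mem_univ i]

theorem derivEval_nonneg (hc : ∀ A ∈ s, 0 < coef A) (hw : ∀ i, 0 < w i) (m : Multiset ι) :
    0 ≤ derivEval s coef a w m :=
  sum_nonneg fun A hA => mul_nonneg (hc A hA).le <| prod_nonneg fun i _ => by
    have := hw i
    positivity

theorem derivEval_pos (hc : ∀ A ∈ s, 0 < coef A) (hw : ∀ i, 0 < w i) {m : Multiset ι} {A : κ}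
    (hA : A ∈ s) (h : ∀ i, m.count i ≤ a A i) : 0 < derivEval s coef a w m := by
  refine sum_pos' (fun A hA => mul_nonneg (hc A hA).le <| prod_nonneg fun i _ => ?_)
    ⟨A, hA, mul_pos (hc A hA) <| prod_pos fun i _ => ?_⟩
  · have := hw i
    positivity
  · exact mul_pos (Nat.cast_pos.2 (Nat.descFactorial_pos.2 (h i))) (pow_pos (hw i) _)

theorem exists_count_le_of_derivEval_ne_zero {m : Multiset ι} (h : derivEval s coef a w m ≠ 0) :
    ∃ A ∈ s, ∀ i, m.count i ≤ a A i := by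
  obtain ⟨A, hA, hA0⟩ := exists_ne_zero_of_sum_ne_zero h
  refine ⟨A, hA, fun i => ?_⟩
  have := prod_ne_zero_iff.1 (right_ne_zero_of_mul hA0) i (mem_univ i)
  by_contra! hlt
  exact this (by rw [Nat.descFactorial_of_lt hlt]; simp)

theorem count_eq_of_count_le (hd : ∀ A ∈ s, ∑ i, a A i = d) {m : Multiset ι} (hm : m.card = d)
    {A : κ} (hA : A ∈ s) (h : ∀ i, m.count i ≤ a A i) : ∀ i, m.count i = a A i := by
  have hsum : ∑ i, m.count i = ∑ i, a A i := by
    rw [hd A hA, ← hm, Multiset.sum_count_eq_card fun i _ => mem_univ i]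
  intro i
  exact (sum_eq_sum_iff_of_le fun i _ => h i).1 hsum i (mem_univ i)

theorem derivEval_eq_of_count_eq (hd : ∀ A ∈ s, ∑ i, a A i = d) (hinj : Set.InjOn a s)
    {m : Multiset ι} (hm : m.card = d) {A : κ} (hA : A ∈ s) (h : ∀ i, m.count i = a A i) :
    derivEval s coef a w m = coef A * ∏ i, ((a A i).factorial : ℝ) := by
  rw [derivEval, sum_eq_single_of_mem A hA]
  · simp [h, Nat.descFactorial_self]
  · intro B hB hBA
    by_contra h0
    refine hBA (hinj hB hA ?_)
    have hle : ∀ i, m.count i ≤ a B i := fun i => by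
      by_contra! hlt
      exact prod_ne_zero_iff.1 (right_ne_zero_of_mul h0) i (mem_univ i)
        (by rw [Nat.descFactorial_of_lt hlt]; simp)
    funext i
    rw [← count_eq_of_count_le hd hm hB hle i, h i]

open Matrix in
/-- If a homogeneous polynomial with nonnegative coefficients has Lorentzian quadratic derivatives
and a variable adjacent to all others in the support of every higher derivative, then the Hessians
of all its derivatives are nonpositive on some hyperplane. -/
theorem exists_derivEval_quadForm_nonpos (hd : ∀ A ∈ s, ∑ i, a A i = d) (hc : ∀ A ∈ s, 0 < coef A)
    (hw : ∀ i, 0 < w i) (o : ι)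
    (hub : ∀ (m : Multiset ι) (i j : ι), m.card + 3 ≤ d → derivEval s coef a w (j ::ₘ i ::ₘ m) ≠ 0 →
      derivEval s coef a w (o ::ₘ i ::ₘ m) ≠ 0)
    (base : ∀ m : Multiset ι, m.card + 2 = d → ∃ l : ι → ℝ, ∀ v, l ⬝ᵥ v = 0 →
      v ⬝ᵥ (Matrix.of fun i j => derivEval s coef a w (i ::ₘ j ::ₘ m)) *ᵥ v ≤ 0)
    (k : ℕ) (m : Multiset ι) (hm : m.card + 2 + k = d) : ∃ l : ι → ℝ, ∀ v, l ⬝ᵥ v = 0 →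
      v ⬝ᵥ (Matrix.of fun i j => derivEval s coef a w (i ::ₘ j ::ₘ m)) *ᵥ v ≤ 0 := by
  induction k generalizing m with
  | zero => exact base m (by omega)
  | succ k ih =>
    have hcst : ∀ m' : Multiset ι, m'.card = m.card + 2 →
        ∑ i, w i * derivEval s coef a w (i ::ₘ m') = (k + 1 : ℕ) * derivEval s coef a w m' := by
      intro m' hm'
      rw [sum_mul_derivEval_cons hd, hm', ← hm]
      push_cast
      ring
    refine ⟨_, quadForm_nonpos_of_slices (c := (k + 1 : ℕ)) (w := w) (o := o)
      (T := fun p => Matrix.of fun i j => derivEval s coef a w (i ::ₘ j ::ₘ p ::ₘ m))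
      ?_ ?_ ?_ ?_ hw ?_ ?_ ?_ ?_ ?_⟩
    · ext i j
      simp [Multiset.cons_swap i j]
    · exact fun i j => derivEval_nonneg hc hw _
    · intro p
      ext i j
      simp [Multiset.cons_swap i j]
    · exact fun p i j => derivEval_nonneg hc hw _
    · positivity
    · intro i j
      simp only [of_apply]
      rw [← hcst _ (by simp)]
      refine sum_congr rfl fun p _ => ?_
      rw [Multiset.cons_swap j p, Multiset.cons_swap i p]
    · intro p i
      simp only [mulVec, dotProduct, of_apply]
      rw [Multiset.cons_swap p i, ← hcst _ (by simp)]
      refine sum_congr rfl fun j _ => ?_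
      rw [mul_comm, Multiset.cons_swap i j]
    · intro i
      by_cases h : ∀ j, derivEval s coef a w (j ::ₘ i ::ₘ m) = 0
      · refine Or.inr fun j => ?_
        rw [of_apply, Multiset.cons_swap, h]
      · obtain ⟨j, hj⟩ := not_forall.1 h
        exact Or.inl ((derivEval_nonneg hc hw _).lt_of_ne' (hub m i j (by omega) hj))
    · exact fun p => ih (p ::ₘ m) (by rw [Multiset.card_cons]; omega)

end DerivEval

section MatroidPolynomial

variable {n : ℕ} {rk : Finset (Fin n) → ℕ} {d : ℕ} {t : ℝ}

theorem IsMatroidRank.indep_subset (h : IsMatroidRank n rk) {A B : Finset (Fin n)} (hA : rk A = #A)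
    (hBA : B ⊆ A) : rk B = #B := by
  have h1 := h.2.2 B (A \ B)
  have h2 := h.1 (A \ B)
  have h3 := h.1 B
  have h4 := card_sdiff_add_card_eq_card hBA
  rw [union_sdiff_of_subset hBA] at h1
  omega

theorem IsMatroidRank.rk_insert_insert_le (h : IsMatroidRank n rk) {S : Finset (Fin n)} {r : ℕ}
    {i j k : Fin n} (hi : r ≤ rk (insert i S)) (hij : rk (insert j (insert i S)) ≤ r)
    (hik : rk (insert k (insert i S)) ≤ r) : rk (insert k (insert j S)) ≤ r := by
  have h1 := h.2.2 (insert j (insert i S)) (insert k (insert i S))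
  have h2 := h.2.1 (insert i S) (insert j (insert i S) ∩ insert k (insert i S))
    (subset_inter (subset_insert _ _) (subset_insert _ _))
  have h3 := h.2.1 (insert k (insert j S)) (insert j (insert i S) ∪ insert k (insert i S)) (by
    intro x
    simp only [mem_insert, mem_union]
    tauto)
  omega

/-- The independent sets of cardinality at most `d`. -/
def indepUpTo (rk : Finset (Fin n) → ℕ) (d : ℕ) : Finset (Finset (Fin n)) :=
  univ.filter fun A => rk A = #A ∧ #A ≤ d

/-- The exponent vector of the monomial of degree `d` obtained by homogenizing `∏ i ∈ A, X i`. -/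
def homogExponent (d : ℕ) (A : Finset (Fin n)) (o : Option (Fin n)) : ℕ :=
  o.elim (d - #A) fun i => if i ∈ A then 1 else 0

/-- The value at the point `(t, 1, …, 1)` of the partial derivative indexed by `m` of the
homogeneous polynomial `∑ A, (n - #A)! / (d - #A)! * y ^ (d - #A) * ∏ i ∈ A, X i`, where `A` runs
over the independent sets of cardinality at most `d`. -/
noncomputable def indepDerivEval (rk : Finset (Fin n) → ℕ) (d : ℕ) (t : ℝ)
    (m : Multiset (Option (Fin n))) : ℝ :=
  derivEval (indepUpTo rk d) (fun A => ((n - #A).factorial : ℝ) / (d - #A).factorial)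
    (homogExponent d) (fun o => o.elim t fun _ => 1) m

theorem sum_homogExponent {A : Finset (Fin n)} (hA : A ∈ indepUpTo rk d) :
    ∑ o, homogExponent d A o = d := by
  have := (mem_filter.1 hA).2.2
  simp [Fintype.sum_option, homogExponent, this]

theorem homogExponent_injective : Function.Injective (homogExponent (n := n) d) := by
  intro A B h
  ext i
  have := congrFun h (some i)
  simp only [homogExponent, Option.elim_some] at this
  split_ifs at this <;> simp_all

theorem indepCoef_pos (A : Finset (Fin n)) :
    0 < ((n - #A).factorial : ℝ) / (d - #A).factorial := by positivity

theorem elim_one_pos (ht : 0 < t) (o : Option (Fin n)) : 0 < (o.elim t fun _ => 1 : ℝ) := by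
  cases o <;> simp [ht]

theorem card_eq_of_count_some {m : Multiset (Option (Fin n))} {S : Finset (Fin n)}
    (hS : ∀ i, m.count (some i) = if i ∈ S then 1 else 0) : m.card = m.count none + #S := by
  rw [← Multiset.sum_count_eq_card (s := univ) fun i _ => mem_univ i, Fintype.sum_option]
  simp [hS]

theorem exists_support_of_indepDerivEval_ne_zero (h : IsMatroidRank n rk)
    {m : Multiset (Option (Fin n))} (hm : indepDerivEval rk d t m ≠ 0) :
    ∃ S, rk S = #S ∧ ∀ i, m.count (some i) = if i ∈ S then 1 else 0 := by
  obtain ⟨A, hA, hle⟩ := exists_count_le_of_derivEval_ne_zero hm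
  refine ⟨univ.filter fun i => some i ∈ m, h.indep_subset (mem_filter.1 hA).2.1 ?_, ?_⟩
  · intro i hi
    have h1 := hle (some i)
    have h2 := Multiset.one_le_count_iff_mem.2 (mem_filter.1 hi).2
    by_contra hiA
    simp only [homogExponent, Option.elim_some, hiA, if_false] at h1
    omega
  · intro i
    have h1 := hle (some i)
    simp only [homogExponent, Option.elim_some] at h1
    by_cases hi : some i ∈ m
    · have h2 := Multiset.one_le_count_iff_mem.2 hi
      simp only [mem_filter, mem_univ, hi, true_and, if_true]
      split_ifs at h1 <;> omega
    · simp [hi]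

theorem indepDerivEval_eq_zero_of_two_le_count {m : Multiset (Option (Fin n))} {i : Fin n}
    (hi : 2 ≤ m.count (some i)) : indepDerivEval rk d t m = 0 := by
  by_contra hm
  obtain ⟨A, -, hle⟩ := exists_count_le_of_derivEval_ne_zero hm
  have h1 := hle (some i)
  simp only [homogExponent, Option.elim_some] at h1
  split_ifs at h1 <;> omega

theorem indepDerivEval_of_card_eq {m : Multiset (Option (Fin n))} (hm : m.card = d)
    {A : Finset (Fin n)} (hA : ∀ i, m.count (some i) = if i ∈ A then 1 else 0) :
    indepDerivEval rk d t m = if rk A = #A then ((n - #A).factorial : ℝ) else 0 := by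
  have hcard := card_eq_of_count_some hA
  split_ifs with hrk
  · have hmem : A ∈ indepUpTo rk d := mem_filter.2 ⟨mem_univ _, hrk, by omega⟩
    rw [indepDerivEval, derivEval_eq_of_count_eq (fun _ => sum_homogExponent)
      homogExponent_injective.injOn hm hmem]
    · rw [Fintype.prod_option, prod_eq_one (s := univ)]
      · simp only [homogExponent, Option.elim_none, mul_one]
        field_simp
      · intro i _
        simp only [homogExponent, Option.elim_some]
        split_ifs <;> simp
    · rintro (_ | i)
      · simp only [homogExponent, Option.elim_none]
        omega
      · simp [homogExponent, hA]
  · by_contra hne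
    obtain ⟨B, hB, hle⟩ := exists_count_le_of_derivEval_ne_zero hne
    have heq := count_eq_of_count_le (fun _ => sum_homogExponent) hm hB hle
    have hBA : B = A := by
      ext i
      have h1 := heq (some i)
      rw [hA] at h1
      simp only [homogExponent, Option.elim_some] at h1
      split_ifs at h1 <;> simp_all
    exact hrk (hBA ▸ (mem_filter.1 hB).2.1)

theorem indepDerivEval_none_cons_ne_zero (h : IsMatroidRank n rk) (ht : 0 < t)
    {m : Multiset (Option (Fin n))} {o : Option (Fin n)} (hm : m.card + 1 ≤ d)
    (ho : indepDerivEval rk d t (o ::ₘ m) ≠ 0) : indepDerivEval rk d t (none ::ₘ m) ≠ 0 := by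
  obtain ⟨A, hA, hle⟩ := exists_count_le_of_derivEval_ne_zero ho
  have hm0 : indepDerivEval rk d t m ≠ 0 :=
    (derivEval_pos (fun A _ => indepCoef_pos A) (elim_one_pos ht) hA fun i =>
      (Multiset.count_le_count_cons _ _ _).trans (hle i)).ne'
  obtain ⟨S, hS, hcount⟩ := exists_support_of_indepDerivEval_ne_zero h hm0
  have hcard := card_eq_of_count_some hcount
  refine (derivEval_pos (fun A _ => indepCoef_pos A) (elim_one_pos ht)
    (mem_filter.2 ⟨mem_univ S, hS, by omega⟩) ?_).ne'
  rintro (_ | i)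
  · simp only [homogExponent, Option.elim_none, Multiset.count_cons_self]
    omega
  · rw [Multiset.count_cons_of_ne (by simp), hcount]
    simp [homogExponent]

open Matrix in
theorem exists_indepDerivEval_quadForm_nonpos_of_card (h : IsMatroidRank n rk) (hdn : d ≤ n)
    (m : Multiset (Option (Fin n))) (hm : m.card + 2 = d) :
    ∃ l : Option (Fin n) → ℝ, ∀ v, l ⬝ᵥ v = 0 →
      v ⬝ᵥ (Matrix.of fun i j => indepDerivEval rk d t (i ::ₘ j ::ₘ m)) *ᵥ v ≤ 0 := by
  by_cases hzero : ∀ i j, indepDerivEval rk d t (i ::ₘ j ::ₘ m) = 0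
  · refine ⟨0, fun v _ => ?_⟩
    simp only [hzero, dotProduct, mulVec, of_apply]
    simp
  push Not at hzero
  obtain ⟨S, hS, hcount⟩ : ∃ S, rk S = #S ∧ ∀ i, m.count (some i) = if i ∈ S then 1 else 0 := by
    obtain ⟨i, j, hij⟩ := hzero
    obtain ⟨S', hS', hc'⟩ := exists_support_of_indepDerivEval_ne_zero h hij
    have hle : ∀ k, m.count k ≤ (i ::ₘ j ::ₘ m).count k := fun k =>
      (Multiset.count_le_count_cons _ _ _).trans (Multiset.count_le_count_cons _ _ _)
    refine ⟨univ.filter fun i => some i ∈ m, h.indep_subset hS' ?_, ?_⟩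
    · intro k hk
      have h1 := hle (some k)
      have h2 := Multiset.one_le_count_iff_mem.2 (mem_filter.1 hk).2
      by_contra hkS
      rw [hc', if_neg hkS] at h1
      omega
    · intro k
      have h1 := hle (some k)
      rw [hc'] at h1
      by_cases hk : some k ∈ m
      · have h2 := Multiset.one_le_count_iff_mem.2 hk
        simp only [mem_filter, mem_univ, hk, true_and, if_true]
        split_ifs at h1 <;> omega
      · simp [hk]
  have hcard := card_eq_of_count_some hcount
  obtain ⟨p, hp⟩ : ∃ p, n - #S = p + 2 := ⟨n - #S - 2, by omega⟩
  set L : Finset (Fin n) := univ.filter fun i => i ∉ S ∧ rk (insert i S) = #S + 1 with hL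
  set f : Fin n → Finset (Fin n) := fun i =>
    univ.filter fun k => rk (insert k (insert i S)) ≤ #S + 1 with hf
  have hLcard : #L ≤ p + 2 := by
    have h1 : #L ≤ #(Sᶜ) := card_le_card fun i hi => mem_compl.2 (mem_filter.1 hi).2.1
    rwa [card_compl, Fintype.card_fin, hp] at h1
  have hf_iff : ∀ i ∈ L, ∀ j ∈ L, f i = f j ↔ rk (insert j (insert i S)) ≤ #S + 1 := by
    intro i hi j hj
    have hi' := (mem_filter.1 hi).2.2
    have hj' := (mem_filter.1 hj).2.2
    constructor
    · intro hij
      have : j ∈ f j := by simp [hf, hj']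
      rw [← hij] at this
      exact (mem_filter.1 this).2
    · intro hij
      have hji : rk (insert i (insert j S)) ≤ #S + 1 := by rwa [insert_comm]
      ext k
      simp only [hf, mem_filter, mem_univ, true_and]
      exact ⟨fun hk => h.rk_insert_insert_le hi'.ge hij hk,
        fun hk => h.rk_insert_insert_le hj'.ge hji hk⟩
  have h00 : indepDerivEval rk d t (none ::ₘ none ::ₘ m) = ((p + 2).factorial : ℝ) := by
    rw [indepDerivEval_of_card_eq (A := S) (by simp [hm]) (by simpa using hcount), if_pos hS, hp]
  have h01 : ∀ i, indepDerivEval rk d t (none ::ₘ some i ::ₘ m)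
      = if i ∈ L then ((p + 1).factorial : ℝ) else 0 := by
    intro i
    by_cases hi : i ∈ S
    · rw [indepDerivEval_eq_zero_of_two_le_count (i := i) (by simp [hcount, hi])]
      simp [hL, hi]
    · rw [indepDerivEval_of_card_eq (A := insert i S) (by simp [hm]) ?_, card_insert_of_notMem hi]
      · simp [hL, hi, show n - (#S + 1) = p + 1 by omega]
      · intro j
        rw [Multiset.count_cons_of_ne (by simp), Multiset.count_cons, hcount]
        by_cases hji : j = i
        · simp [hji, hi]
        · simp [hji]
  have h11 : ∀ i j, indepDerivEval rk d t (some i ::ₘ some j ::ₘ m)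
      = if i ∈ L then if j ∈ L then if f i = f j then 0 else (p.factorial : ℝ) else 0 else 0 := by
    intro i j
    by_cases hi : i ∈ S
    · rw [indepDerivEval_eq_zero_of_two_le_count (i := i)
        (by simp only [Multiset.count_cons, hcount, hi]; simp)]
      simp [hL, hi]
    by_cases hj : j ∈ S
    · rw [indepDerivEval_eq_zero_of_two_le_count (i := j)
        (by simp only [Multiset.count_cons, hcount, hj]; simp)]
      simp [hL, hj]
    by_cases hij : i = j
    · subst hij
      rw [indepDerivEval_eq_zero_of_two_le_count (i := i) (by simp)]
      simp
    have hji : j ∉ insert i S := by simp [hj, Ne.symm hij]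
    have hc2 : #(insert j (insert i S)) = #S + 2 := by
      rw [card_insert_of_notMem hji, card_insert_of_notMem hi]
    rw [indepDerivEval_of_card_eq (A := insert j (insert i S)) (by simp [hm]) ?_, hc2]
    · by_cases hind : rk (insert j (insert i S)) = #S + 2
      · have h1 : rk (insert i S) = #S + 1 := by
          rw [h.indep_subset (hind.trans hc2.symm) (subset_insert _ _), card_insert_of_notMem hi]
        have h2 : rk (insert j S) = #S + 1 := by
          rw [h.indep_subset (hind.trans hc2.symm) (insert_subset_insert _ (subset_insert _ _)),
            card_insert_of_notMem hj]
        have hiL : i ∈ L := by simp [hL, hi, h1]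
        have hjL : j ∈ L := by simp [hL, hj, h2]
        rw [if_pos hind, if_pos hiL, if_pos hjL, if_neg (by rw [hf_iff i hiL j hjL]; omega),
          show n - (#S + 2) = p by omega]
      · rw [if_neg hind]
        split_ifs with hiL hjL hfij
        · rfl
        · rw [hf_iff i hiL j hjL] at hfij
          have := h.1 (insert j (insert i S))
          omega
        · rfl
        · rfl
    · intro k
      rw [Multiset.count_cons, Multiset.count_cons, hcount]
      by_cases hki : k = i
      · subst hki
        simp [hi, hij]
      · by_cases hkj : k = j
        · subst hkj
          simp [hki, hj]
        · simp [hki, hkj]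
  refine ⟨fun o => o.elim (p + 2) fun i => if i ∈ L then 1 else 0, fun v hv => ?_⟩
  set x : Fin n → ℝ := fun i => v (some i) with hx
  set R := ∑ i ∈ L, ∑ j ∈ L, (if f i = f j then x i * x j else 0) with hR
  have hv' : (p + 2) * v none + ∑ i ∈ L, x i = 0 := by
    rw [← hv]
    simp [dotProduct, Fintype.sum_option, hx]
  have hCS : (∑ i ∈ L, x i) ^ 2 ≤ (p + 2) * R := by
    have hR0 : 0 ≤ R := by
      rcases L.eq_empty_or_nonempty with hL0 | hL0
      · simp [hR, hL0]
      · have := (sq_nonneg _).trans (sq_sum_le_card_mul_sum_fiber L f x)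
        exact nonneg_of_mul_nonneg_right this (by exact_mod_cast hL0.card_pos)
    refine (sq_sum_le_card_mul_sum_fiber L f x).trans ?_
    exact mul_le_mul_of_nonneg_right (by exact_mod_cast hLcard) hR0
  have hoff : ∑ i ∈ L, ∑ j ∈ L, (if f i = f j then 0 else x i * x j)
      = (∑ i ∈ L, x i) ^ 2 - R := by
    rw [sq, sum_mul_sum, hR, ← sum_sub_distrib]
    refine sum_congr rfl fun i _ => ?_
    rw [← sum_sub_distrib]
    exact sum_congr rfl fun j _ => by split_ifs <;> ring
  have hquad : v ⬝ᵥ (Matrix.of fun i j => indepDerivEval rk d t (i ::ₘ j ::ₘ m)) *ᵥ v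
      = (p + 2).factorial * v none ^ 2 + 2 * (p + 1).factorial * v none * ∑ i ∈ L, x i
        + p.factorial * ∑ i ∈ L, ∑ j ∈ L, (if f i = f j then 0 else x i * x j) := by
    have h10 : ∀ i, indepDerivEval rk d t (some i ::ₘ none ::ₘ m)
        = if i ∈ L then ((p + 1).factorial : ℝ) else 0 := fun i => by
      rw [Multiset.cons_swap, h01]
    simp only [dotProduct, mulVec, of_apply, Fintype.sum_option, h00, h01, h10, h11]
    have e1 : ∀ i, v (some i) * ((if i ∈ L then ((p + 1).factorial : ℝ) else 0) * v none +
        ∑ j, (if i ∈ L then if j ∈ L then if f i = f j then 0 else (p.factorial : ℝ) else 0 else 0)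
          * v (some j)) = if i ∈ L then (p + 1).factorial * v none * x i +
          p.factorial * ∑ j ∈ L, (if f i = f j then 0 else x i * x j) else 0 := by
      intro i
      by_cases hi : i ∈ L
      · simp only [hi, if_true, ite_mul, zero_mul, sum_ite_mem, univ_inter, mul_add, mul_sum]
        congr 1
        · ring
        · refine sum_congr rfl fun j _ => ?_
          split_ifs
          · simp
          · ring
      · simp [hi]
    have hx' : ∀ i, v (some i) = x i := fun _ => rfl
    rw [sum_congr rfl fun i _ => e1 i]
    simp only [hx', ite_mul, zero_mul, sum_ite_mem, univ_inter, sum_add_distrib, ← mul_sum]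
    ring
  rw [hquad, hoff, Nat.factorial_succ (p + 1), Nat.factorial_succ p]
  push_cast
  set X := ∑ i ∈ L, x i
  have hX : X = -((p + 2) * v none) := by linarith
  have hp0 : (0 : ℝ) < p + 2 := by positivity
  have hfin : (p + 2) * v none ^ 2 ≤ R := by
    refine le_of_mul_le_mul_left ?_ hp0
    rw [hX] at hCS
    linarith
  have hpf : (0 : ℝ) < p.factorial := by positivity
  rw [hX]
  have : (0 : ℝ) ≤ p.factorial * (R - (p + 2) * v none ^ 2) :=
    mul_nonneg hpf.le (sub_nonneg.2 hfin)
  linarith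

/-- The ultra-log-concavity inequality before specializing `t` to zero. -/
theorem indepDerivEval_mul_le_sq (h : IsMatroidRank n rk) (ht : 0 < t) {k : ℕ} (hk : 0 < k)
    (hkn : k + 1 ≤ n) :
    (k + 1) * indepDerivEval rk (k + 1) t 0 * indepDerivEval rk (k + 1) t {none, none}
      ≤ k * indepDerivEval rk (k + 1) t {none} ^ 2 := by
  set Φ := indepDerivEval rk (k + 1) t
  set w : Option (Fin n) → ℝ := fun o => o.elim t fun _ => 1
  have hd : ∀ A ∈ indepUpTo rk (k + 1), ∑ i, homogExponent (k + 1) A i = k + 1 :=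
    fun _ => sum_homogExponent
  obtain ⟨l, hl⟩ := exists_derivEval_quadForm_nonpos hd (fun A _ => indepCoef_pos A)
    (elim_one_pos ht) none
    (fun m i j hm => indepDerivEval_none_cons_ne_zero h ht (by rw [Multiset.card_cons]; omega))
    (fun m hm => exists_indepDerivEval_quadForm_nonpos_of_card h hkn m hm) (k - 1) 0
    (by simp; omega)
  set H : Matrix (Option (Fin n)) (Option (Fin n)) ℝ := Matrix.of fun i j => Φ (i ::ₘ j ::ₘ 0)
  have hH : H.IsSymm := by
    ext i j
    change Φ (j ::ₘ i ::ₘ 0) = Φ (i ::ₘ j ::ₘ 0)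
    rw [Multiset.cons_swap]
  have hHw : ∀ i, (H.mulVec w) i = k * Φ (i ::ₘ 0) := by
    intro i
    have := sum_mul_derivEval_cons (w := w)
      (coef := fun A => ((n - #A).factorial : ℝ) / (k + 1 - #A).factorial) hd (i ::ₘ 0)
    rw [Multiset.card_cons, Multiset.card_zero, Nat.cast_succ] at this
    rw [zero_add, Nat.cast_one, add_sub_cancel_right] at this
    refine Eq.trans ?_ this
    change ∑ j, Φ (i ::ₘ j ::ₘ 0) * w j = ∑ j, w j * Φ (j ::ₘ i ::ₘ 0)
    exact sum_congr rfl fun j _ => by rw [mul_comm, Multiset.cons_swap]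
  have hHww : w ⬝ᵥ H.mulVec w = k * ((k + 1) * Φ 0) := by
    have := sum_mul_derivEval_cons (w := w)
      (coef := fun A => ((n - #A).factorial : ℝ) / (k + 1 - #A).factorial) hd 0
    simp only [Multiset.card_zero] at this
    push_cast at this
    rw [sub_zero] at this
    simp only [dotProduct, hHw]
    refine Eq.trans ?_ (congrArg (fun z => (k : ℝ) * z) this)
    rw [mul_sum]
    refine sum_congr rfl fun i _ => ?_
    change w i * (k * Φ (i ::ₘ 0)) = k * (w i * Φ (i ::ₘ 0))
    ring
  have hΦ : ∀ m, 0 ≤ Φ m := derivEval_nonneg (fun A _ => indepCoef_pos A) (elim_one_pos ht)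
  have key := mul_quadForm_le_sq hH l hl w (by rw [hHww]; have := hΦ 0; positivity)
    (Pi.single none 1)
  rw [hHww, single_dotProduct, single_dotProduct, hHw, Matrix.mulVec_single] at key
  simp only [one_mul, MulOpposite.op_one, one_smul, Matrix.col_apply] at key
  have hk' : (0 : ℝ) < k := by exact_mod_cast hk
  refine le_of_mul_le_mul_left ?_ hk'
  have e : H none none = Φ {none, none} := rfl
  have e' : Φ (none ::ₘ 0) = Φ {none} := rfl
  rw [e, e'] at key
  linarith

open Filter Topology in
theorem tendsto_indepDerivEval {c k : ℕ} (hck : c + k = d) :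
    Tendsto (fun t => indepDerivEval rk d t (Multiset.replicate c none)) (𝓝[>] 0)
      (𝓝 ((n - k).factorial * Ik n rk k)) := by
  have hval : ∀ t, indepDerivEval rk d t (Multiset.replicate c none)
      = ∑ A ∈ indepUpTo rk d, ((n - #A).factorial : ℝ) / (d - #A).factorial *
        ((d - #A).descFactorial c * t ^ (d - #A - c)) := by
    intro t
    rw [indepDerivEval, derivEval]
    refine sum_congr rfl fun A _ => ?_
    rw [Fintype.prod_option, prod_eq_one (s := univ)]
    · simp [homogExponent]
    · intro i _
      simp [homogExponent, Multiset.count_replicate]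
  have hcont : Continuous fun t => indepDerivEval rk d t (Multiset.replicate c none) := by
    simp only [hval]
    fun_prop
  refine (hcont.tendsto' 0 _ ?_).mono_left nhdsWithin_le_nhds
  rw [hval]
  have hIk : ((n - k).factorial * Ik n rk k : ℝ)
      = ∑ A ∈ indepUpTo rk d, if #A = k then ((n - k).factorial : ℝ) else 0 := by
    rw [← sum_filter, sum_const, nsmul_eq_mul, mul_comm, Ik]
    congr 3
    ext A
    simp only [mem_filter, mem_powersetCard, subset_univ, true_and, indepUpTo, mem_univ]
    constructor
    · rintro ⟨h1, h2⟩
      exact ⟨⟨h2, by omega⟩, h1⟩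
    · rintro ⟨⟨h1, -⟩, h2⟩
      exact ⟨h2, h1⟩
  rw [hIk]
  refine sum_congr rfl fun A hA => ?_
  have hAd := (mem_filter.1 hA).2.2
  split_ifs with hAk
  · rw [hAk, show d - k = c by omega, Nat.descFactorial_self]
    simp only [Nat.sub_self, pow_zero, mul_one]
    field_simp
  · rcases lt_or_ge (d - #A) c with hlt | hge
    · simp [Nat.descFactorial_of_lt hlt]
    · rw [zero_pow (by omega)]
      simp

end MatroidPolynomial

theorem statement13 (n : ℕ) (hn : 2 ≤ n) (rk : Finset (Fin n) → ℕ)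
    (hrk : IsMatroidRank n rk) (k : ℕ) (hk0 : 0 < k) (hkn : k < n) :
    (((k : ℝ) + 1) / (k : ℝ)) * (((n : ℝ) - (k : ℝ) + 1) / ((n : ℝ) - (k : ℝ))) *
      (Ik n rk (k-1) : ℝ) * (Ik n rk (k+1) : ℝ) ≤ ((Ik n rk k : ℝ)) ^ 2 := by
  have h0 := tendsto_indepDerivEval (rk := rk) (c := 0) (k := k + 1) (d := k + 1) (by omega)
  have h1 := tendsto_indepDerivEval (rk := rk) (c := 1) (k := k) (d := k + 1) (by omega)
  have h2 := tendsto_indepDerivEval (rk := rk) (c := 2) (k := k - 1) (d := k + 1) (by omega)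
  have key := le_of_tendsto_of_tendsto ((h0.const_mul ((k : ℝ) + 1)).mul h2)
    ((h1.pow 2).const_mul (k : ℝ))
    (eventually_nhdsWithin_of_forall fun t ht => indepDerivEval_mul_le_sq hrk ht hk0 hkn)
  obtain ⟨p, rfl⟩ : ∃ p, n = k + (p + 1) := ⟨n - k - 1, by omega⟩
  rw [show k + (p + 1) - (k + 1) = p by omega, show k + (p + 1) - k = p + 1 by omega,
    show k + (p + 1) - (k - 1) = p + 2 by omega, Nat.factorial_succ (p + 1),
    Nat.factorial_succ p] at key
  push_cast at key ⊢
  have hk' : (0 : ℝ) < k := by exact_mod_cast hk0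
  have hp : (0 : ℝ) < (p : ℝ) + 1 := by positivity
  have hpf : (0 : ℝ) < p.factorial := by positivity
  rw [show (k : ℝ) + (p + 1) - k = p + 1 by ring, div_mul_div_comm, div_mul_eq_mul_div,
    div_mul_eq_mul_div, div_le_iff₀ (by positivity)]
  refine le_of_mul_le_mul_left ?_ (show (0 : ℝ) < (p + 1) * p.factorial ^ 2 by positivity)
  linarith
end

section
/- Let n ≥ 2, let M be a matroid on [n], and let k be a positive integer. Then I_k(M)² ≥ ((k+1)/k)·I_{k−1}(M)·I_{k+1}(M), where I_j(M) denotes the number of j-element independent sets of M. -/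
open Finset

open Matrix in
/-- The quadratic form of `H` satisfies the reverse Cauchy–Schwarz inequality against `w`. -/
def ReverseCauchy {V : Type*} [Fintype V] (H : Matrix V V ℝ) (w : V → ℝ) : Prop :=
  ∀ v : V → ℝ, (v ⬝ᵥ H *ᵥ v) * (w ⬝ᵥ H *ᵥ w) ≤ (v ⬝ᵥ H *ᵥ w) ^ 2

section LinearAlgebra

open Matrix

variable {V : Type*} [Fintype V]

theorem dotProduct_mulVec_nonpos_of_orthogonal [DecidableEq V] {B : Matrix V V ℝ}
    (hB : B.IsHermitian) (x : V → ℝ)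
    (h : ∀ (μ : ℝ) (e : V → ℝ), 0 < μ → B *ᵥ e = μ • e → e ⬝ᵥ x = 0) :
    x ⬝ᵥ B *ᵥ x ≤ 0 := by
  set b := hB.eigenvectorBasis
  have key := b.sum_inner_mul_inner (WithLp.toLp 2 x) (WithLp.toLp 2 (B *ᵥ x))
  have e1 : inner ℝ (WithLp.toLp 2 x) (WithLp.toLp 2 (B *ᵥ x)) = x ⬝ᵥ B *ᵥ x := by
    simp [EuclideanSpace.inner_eq_star_dotProduct, dotProduct_comm]
  rw [← e1, ← key]
  refine Finset.sum_nonpos fun i _ => ?_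
  have e2 : inner ℝ (WithLp.toLp 2 x) (b i) = (b i).ofLp ⬝ᵥ x := by
    simp [EuclideanSpace.inner_eq_star_dotProduct]
  have e3 : inner ℝ (b i) (WithLp.toLp 2 (B *ᵥ x)) =
      hB.eigenvalues i * ((b i).ofLp ⬝ᵥ x) := by
    have hT : Bᵀ = B := (conjTranspose_eq_transpose_of_trivial B).symm.trans hB
    have : inner ℝ (b i) (WithLp.toLp 2 (B *ᵥ x)) = (B *ᵥ x) ⬝ᵥ (b i).ofLp := by
      simp [EuclideanSpace.inner_eq_star_dotProduct]
    rw [this, dotProduct_comm, dotProduct_mulVec, ← mulVec_transpose, hT,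
      hB.mulVec_eigenvectorBasis i, smul_dotProduct, smul_eq_mul]
  rw [e2, e3]
  rcases le_or_gt (hB.eigenvalues i) 0 with hl | hl
  · nlinarith [mul_nonneg (neg_nonneg.2 hl) (sq_nonneg ((b i).ofLp ⬝ᵥ x))]
  · rw [h _ _ hl (hB.mulVec_eigenvectorBasis i)]
    simp

theorem dotProduct_mulVec_symm {H : Matrix V V ℝ} (hs : ∀ i j, H i j = H j i) (u v : V → ℝ) :
    u ⬝ᵥ H *ᵥ v = v ⬝ᵥ H *ᵥ u := by
  have hT : Hᵀ = H := by ext i j; exact hs j i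
  rw [dotProduct_mulVec, ← mulVec_transpose, hT, dotProduct_comm]

theorem reverseCauchy_of_orthogonal {H : Matrix V V ℝ} (hs : ∀ i j, H i j = H j i) {w : V → ℝ}
    (hw : 0 ≤ w ⬝ᵥ H *ᵥ w) (h : ∀ v : V → ℝ, v ⬝ᵥ H *ᵥ w = 0 → v ⬝ᵥ H *ᵥ v ≤ 0) :
    ReverseCauchy H w := by
  intro v
  rcases hw.eq_or_lt with h0 | hpos
  · rw [← h0, mul_zero]; positivity
  set q := w ⬝ᵥ H *ᵥ w with hq
  set r := v ⬝ᵥ H *ᵥ w with hr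
  have hr' : w ⬝ᵥ H *ᵥ v = r := dotProduct_mulVec_symm hs w v
  have h1 := h (q • v - r • w) (by
    simp only [sub_dotProduct, smul_dotProduct, smul_eq_mul]
    change q * r - r * q = 0
    ring)
  have h2 : (q • v - r • w) ⬝ᵥ H *ᵥ (q • v - r • w) =
      q * ((v ⬝ᵥ H *ᵥ v) * q - r ^ 2) := by
    simp only [mulVec_sub, mulVec_smul, dotProduct_sub, sub_dotProduct, smul_dotProduct,
      dotProduct_smul, smul_eq_mul, hr']
    rw [← hr, ← hq]
    ring
  rw [h2] at h1
  by_contra hcon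
  push Not at hcon
  nlinarith [mul_pos hpos (sub_pos.2 hcon)]

/-- A generalized eigenvector for an eigenvalue at least one is proportional to the
Perron–Frobenius vector `w`. -/
theorem proportional_of_le_eigenvalue {H : Matrix V V ℝ} (hs : ∀ i j, H i j = H j i)
    (hn : ∀ i j, 0 ≤ H i j) {w : V → ℝ} (hw : ∀ i, 0 < w i) (y : V)
    (v : V → ℝ) (hle : ∑ i, (H *ᵥ w) i / w i * v i ^ 2 ≤ v ⬝ᵥ H *ᵥ v)
    (i : V) (hi : 0 < H i y) : v i = v y / w y * w i := by
  have hid : ∑ i, ∑ j, H i j * (w i * w j * (v i / w i - v j / w j) ^ 2) =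
      2 * (∑ i, (H *ᵥ w) i / w i * v i ^ 2 - v ⬝ᵥ H *ᵥ v) := by
    have e1 : ∑ i, ∑ j, H i j * (w i * w j * (v i / w i - v j / w j) ^ 2) =
        ∑ i, ∑ j, H i j * w j / w i * v i ^ 2 + ∑ i, ∑ j, H i j * w i / w j * v j ^ 2
          - 2 * ∑ i, ∑ j, v i * (H i j * v j) := by
      simp only [Finset.mul_sum, ← Finset.sum_add_distrib, ← Finset.sum_sub_distrib]
      refine Finset.sum_congr rfl fun i _ => Finset.sum_congr rfl fun j _ => ?_
      have := (hw i).ne'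
      have := (hw j).ne'
      field_simp
      ring
    have e2 : ∑ i, ∑ j, H i j * w i / w j * v j ^ 2 = ∑ i, ∑ j, H i j * w j / w i * v i ^ 2 := by
      rw [Finset.sum_comm]
      exact Finset.sum_congr rfl fun i _ => Finset.sum_congr rfl fun j _ => by rw [hs j i]
    rw [e1, e2]
    simp only [dotProduct, mulVec, Finset.sum_div, Finset.sum_mul, Finset.mul_sum,
      mul_sub, ← Finset.sum_sub_distrib, ← Finset.sum_add_distrib]
    refine Finset.sum_congr rfl fun i _ => Finset.sum_congr rfl fun j _ => ?_
    ring
  have hterm : ∀ i j, 0 ≤ H i j * (w i * w j * (v i / w i - v j / w j) ^ 2) := fun i j =>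
    mul_nonneg (hn i j) (mul_nonneg (mul_pos (hw i) (hw j)).le (sq_nonneg _))
  have h0 : H i y * (w i * w y * (v i / w i - v y / w y) ^ 2) ≤ 0 := by
    calc _ ≤ ∑ j, H i j * (w i * w j * (v i / w i - v j / w j) ^ 2) :=
          Finset.single_le_sum (f := fun j => H i j * (w i * w j * (v i / w i - v j / w j) ^ 2))
            (fun j _ => hterm i j) (Finset.mem_univ y)
      _ ≤ ∑ i, ∑ j, H i j * (w i * w j * (v i / w i - v j / w j) ^ 2) :=
          Finset.single_le_sum
            (f := fun i => ∑ j, H i j * (w i * w j * (v i / w i - v j / w j) ^ 2))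
            (fun i _ => Finset.sum_nonneg fun j _ => hterm i j) (Finset.mem_univ i)
      _ ≤ 0 := by rw [hid]; linarith
  have h1 : (v i / w i - v y / w y) ^ 2 ≤ 0 := by
    rw [← mul_assoc] at h0
    exact nonpos_of_mul_nonpos_right h0 (mul_pos hi (mul_pos (hw i) (hw y)))
  have h2 : v i / w i - v y / w y = 0 := by
    exact pow_eq_zero_iff (two_ne_zero) |>.1 (le_antisymm h1 (sq_nonneg _))
  rw [← sub_eq_zero.1 h2, div_mul_cancel₀ _ (hw i).ne']

theorem reverseCauchy_of_le_sum_sq_div {H : Matrix V V ℝ} (hs : ∀ i j, H i j = H j i)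
    (hn : ∀ i j, 0 ≤ H i j) {w : V → ℝ} (hw : ∀ i, 0 < w i) (y : V)
    (hy : ∀ i j, H i j ≠ 0 → 0 < H i y)
    (hH : ∀ v : V → ℝ, v ⬝ᵥ H *ᵥ v ≤ ∑ i, w i * ((H *ᵥ v) i ^ 2 / (H *ᵥ w) i)) :
    ReverseCauchy H w := by
  classical
  have hHw : ∀ i, 0 ≤ (H *ᵥ w) i := fun i =>
    Finset.sum_nonneg fun j _ => mul_nonneg (hn i j) (hw j).le
  refine reverseCauchy_of_orthogonal hs
    (Finset.sum_nonneg fun i _ => mul_nonneg (hw i).le (hHw i)) fun v hv => ?_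
  set d : V → ℝ := fun i => √((H *ᵥ w) i / w i) with hd
  have hdsq : ∀ i, d i ^ 2 = (H *ᵥ w) i / w i := fun i =>
    Real.sq_sqrt (div_nonneg (hHw i) (hw i).le)
  have hd0 : ∀ i, d i = 0 → ∀ j, H i j = 0 := by
    intro i hi j
    have h1 : (H *ᵥ w) i = 0 := by
      have := hdsq i
      rw [hi, zero_pow two_ne_zero, eq_comm, div_eq_zero_iff] at this
      exact this.resolve_right (hw i).ne'
    have h2 := (Finset.sum_eq_zero_iff_of_nonneg
      (fun j _ => mul_nonneg (hn i j) (hw j).le)).1 h1 j (Finset.mem_univ j)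
    exact (mul_eq_zero.1 h2).resolve_right (hw j).ne'
  set B : Matrix V V ℝ := Matrix.of fun i j => H i j / (d i * d j) with hBdef
  have hB : B.IsHermitian := by
    ext i j
    simp [hBdef, hs j i, mul_comm]
  have hBmul : ∀ (z : V → ℝ) (i : V), d i * (B *ᵥ z) i = (H *ᵥ fun j => z j / d j) i := by
    intro z i
    simp only [mulVec, dotProduct, Finset.mul_sum, hBdef, of_apply]
    refine Finset.sum_congr rfl fun j _ => ?_
    by_cases hi : d i = 0
    · simp [hd0 i hi j]
    · rw [show H i j / (d i * d j) = (H i j / d j) / d i by rw [div_div, mul_comm]]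
      field_simp
  have main := dotProduct_mulVec_nonpos_of_orthogonal hB (fun i => d i * v i) (by
    intro μ e hμ he
    set z : V → ℝ := fun j => e j / d j with hz
    have hei : ∀ i, d i = 0 → e i = 0 := by
      intro i hi
      have h1 : (B *ᵥ e) i = 0 := by
        simp [mulVec, dotProduct, hBdef, hi]
      rw [he] at h1
      simpa [hμ.ne'] using h1
    have hez : ∀ i, e i = d i * z i := by
      intro i
      by_cases hi : d i = 0
      · rw [hei i hi, hi, zero_mul]
      · simp only [hz]; field_simp
    have hHz : ∀ i, (H *ᵥ z) i = μ * ((H *ᵥ w) i / w i) * z i := by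
      intro i
      rw [← hBmul, he, Pi.smul_apply, smul_eq_mul, hez i, ← hdsq i]
      ring
    have hq : z ⬝ᵥ H *ᵥ z = μ * ∑ i, (H *ᵥ w) i / w i * z i ^ 2 := by
      rw [Finset.mul_sum]
      exact Finset.sum_congr rfl fun i _ => by rw [hHz]; ring
    have hle := hH z
    have hr : ∑ i, w i * ((H *ᵥ z) i ^ 2 / (H *ᵥ w) i) =
        μ ^ 2 * ∑ i, (H *ᵥ w) i / w i * z i ^ 2 := by
      rw [Finset.mul_sum]
      refine Finset.sum_congr rfl fun i _ => ?_
      rw [hHz]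
      have := (hw i).ne'
      by_cases h0 : (H *ᵥ w) i = 0
      · simp [h0]
      · field_simp
    rw [hq, hr] at hle
    have hS : 0 ≤ ∑ i, (H *ᵥ w) i / w i * z i ^ 2 :=
      Finset.sum_nonneg fun i _ => mul_nonneg (div_nonneg (hHw i) (hw i).le) (sq_nonneg _)
    have hle' : ∑ i, (H *ᵥ w) i / w i * z i ^ 2 ≤ z ⬝ᵥ H *ᵥ z := by
      rw [hq]
      have : 0 ≤ μ * ((μ * ∑ i, (H *ᵥ w) i / w i * z i ^ 2)
          - ∑ i, (H *ᵥ w) i / w i * z i ^ 2) := by linarith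
      linarith [nonneg_of_mul_nonneg_right this hμ]
    have hprop := proportional_of_le_eigenvalue hs hn hw y z hle'
    have : e ⬝ᵥ (fun i => d i * v i) = (z y / w y) * (v ⬝ᵥ H *ᵥ w) := by
      simp only [dotProduct, Finset.mul_sum]
      refine Finset.sum_congr rfl fun i _ => ?_
      by_cases hi : ∃ j, H i j ≠ 0
      · obtain ⟨j, hj⟩ := hi
        rw [hez, hprop i (hy i j hj)]
        have h1 : (H *ᵥ w) i = d i ^ 2 * w i := by
          rw [hdsq, div_mul_cancel₀ _ (hw i).ne']
        rw [h1]; ring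
      · push Not at hi
        have h1 : (H *ᵥ w) i = 0 := by simp [mulVec, dotProduct, hi]
        have h2 : d i = 0 := by simp [hd, h1]
        rw [h1, h2]; ring
    rw [this, hv, mul_zero])
  have e : (fun i => d i * v i) ⬝ᵥ B *ᵥ (fun i => d i * v i) = v ⬝ᵥ H *ᵥ v := by
    simp only [dotProduct, mulVec, Finset.mul_sum, hBdef, of_apply]
    refine Finset.sum_congr rfl fun i _ => Finset.sum_congr rfl fun j _ => ?_
    by_cases hi : d i = 0
    · simp [hd0 i hi j, hi]
    by_cases hj : d j = 0
    · simp [hs i j, hd0 j hj i, hj]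
    field_simp
  rwa [e] at main

end LinearAlgebra

section Trickle

open Matrix

variable {V X : Type*} [Fintype V]

/-- The value at `w` of the degree `d` homogeneous polynomial whose iterated partial derivatives
of order `d` are the values of `c` at the states reached from `s` under `act`. -/
noncomputable def stateSum (c : X → ℝ) (act : V → X → X) (w : V → ℝ) : ℕ → X → ℝ
  | 0, s => c s
  | d + 1, s => (∑ a, w a * stateSum c act w d (act a s)) / (d + 1)

/-- The Hessian at `w` of the polynomial of degree `d + 2` described by `stateSum`. -/
noncomputable def stateHessian (c : X → ℝ) (act : V → X → X) (w : V → ℝ) (d : ℕ) (s : X) :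
    Matrix V V ℝ :=
  Matrix.of fun a b => stateSum c act w d (act a (act b s))

variable {c : X → ℝ} {act : V → X → X} {w : V → ℝ}

theorem sum_mul_stateSum (d : ℕ) (s : X) :
    ∑ a, w a * stateSum c act w d (act a s) = (d + 1) * stateSum c act w (d + 1) s := by
  rw [stateSum]
  field_simp

theorem stateSum_nonneg (hc : ∀ s, 0 ≤ c s) (hw : ∀ a, 0 ≤ w a) (d : ℕ) (s : X) :
    0 ≤ stateSum c act w d s := by
  induction d generalizing s with
  | zero => exact hc s
  | succ d ih =>
    rw [stateSum]
    exact div_nonneg (Finset.sum_nonneg fun a _ => mul_nonneg (hw a) (ih _)) (by positivity)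

theorem stateSum_eq_zero (h0 : ∀ a s, c s = 0 → c (act a s) = 0) (d : ℕ) {s : X} (hs : c s = 0) :
    stateSum c act w d s = 0 := by
  induction d generalizing s with
  | zero => exact hs
  | succ d ih =>
    rw [stateSum, Finset.sum_eq_zero fun a _ => by rw [ih (h0 a s hs), mul_zero], zero_div]

theorem stateSum_pos (hc : ∀ s, 0 ≤ c s) (hw : ∀ a, 0 < w a) (y : V)
    (hy : ∀ s, c s ≠ 0 → c (act y s) ≠ 0) (d : ℕ) {s : X} (hs : c s ≠ 0) :
    0 < stateSum c act w d s := by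
  induction d generalizing s with
  | zero => exact (hc s).lt_of_ne' hs
  | succ d ih =>
    rw [stateSum]
    refine div_pos (Finset.sum_pos' (fun a _ => mul_nonneg (hw a).le
      (stateSum_nonneg hc (fun a => (hw a).le) _ _)) ⟨y, Finset.mem_univ y, ?_⟩) (by positivity)
    exact mul_pos (hw y) (ih (hy s hs))

/-- Local-to-global principle: if all the Hessians of degree two derivatives satisfy the reverse
Cauchy–Schwarz inequality, then so do all the Hessians. -/
theorem reverseCauchy_stateHessian (hcomm : ∀ a b s, act a (act b s) = act b (act a s))
    (hc : ∀ s, 0 ≤ c s) (hw : ∀ a, 0 < w a) (h0 : ∀ a s, c s = 0 → c (act a s) = 0) (y : V)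
    (hy : ∀ s, c s ≠ 0 → c (act y s) ≠ 0)
    (hbase : ∀ s, ReverseCauchy (stateHessian c act w 0 s) w) (d : ℕ) (s : X) :
    ReverseCauchy (stateHessian c act w d s) w := by
  have hG := stateSum_nonneg (act := act) hc (fun a => (hw a).le)
  induction d generalizing s with
  | zero => exact hbase s
  | succ d ih =>
    set H := stateHessian c act w (d + 1) s
    have hHab : ∀ a b, H a b = stateSum c act w (d + 1) (act a (act b s)) := fun a b => rfl
    have hrow : ∀ i a, (stateHessian c act w d (act i s) *ᵥ w) a = (d + 1) * H i a := by
      intro i a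
      rw [hHab, ← hcomm a i, ← sum_mul_stateSum]
      refine Finset.sum_congr rfl fun b _ => ?_
      simp only [stateHessian, of_apply]
      rw [hcomm b a, mul_comm]
    have hvw : ∀ (v : V → ℝ) i, v ⬝ᵥ stateHessian c act w d (act i s) *ᵥ w =
        (d + 1) * (H *ᵥ v) i := by
      intro v i
      rw [dotProduct]
      simp only [hrow]
      simp only [dotProduct, mulVec, Finset.mul_sum]
      exact Finset.sum_congr rfl fun a _ => by ring
    have hd : (0 : ℝ) < d + 1 := by positivity
    have hs : ∀ i j, H i j = H j i := fun i j => by rw [hHab, hHab, hcomm]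
    have hn : ∀ i j, 0 ≤ H i j := fun i j => hG _ _
    refine reverseCauchy_of_le_sum_sq_div hs hn hw y (fun i j hij => ?_) fun v => ?_
    · rw [hHab, hcomm]
      refine stateSum_pos hc hw y hy _ (hy _ fun h => hij ?_)
      rw [hHab, hcomm]
      exact stateSum_eq_zero h0 _ (h0 _ _ h)
    · have hsum : (d + 1) * (v ⬝ᵥ H *ᵥ v) =
          ∑ i, w i * (v ⬝ᵥ stateHessian c act w d (act i s) *ᵥ v) := by
        simp only [dotProduct, mulVec, Finset.mul_sum]
        conv_rhs => rw [Finset.sum_comm]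
        refine Finset.sum_congr rfl fun a _ => ?_
        conv_rhs => rw [Finset.sum_comm]
        refine Finset.sum_congr rfl fun b _ => ?_
        rw [hHab]
        calc _ = v a * v b * ((d + 1) * stateSum c act w (d + 1) (act a (act b s))) := by ring
          _ = _ := by
            rw [← sum_mul_stateSum, Finset.mul_sum]
            refine Finset.sum_congr rfl fun i _ => ?_
            simp only [stateHessian, of_apply]
            rw [hcomm i a, hcomm i b]; ring
      refine le_of_mul_le_mul_left ?_ hd
      rw [hsum, Finset.mul_sum]
      refine Finset.sum_le_sum fun i _ => ?_
      rw [mul_left_comm]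
      refine mul_le_mul_of_nonneg_left ?_ (hw i).le
      have hHw : 0 ≤ (H *ᵥ w) i :=
        Finset.sum_nonneg fun j _ => mul_nonneg (hG _ _) (hw j).le
      rcases hHw.eq_or_lt with hz | hp
      · rw [← hz, div_zero, mul_zero]
        have hHi : ∀ a, H i a = 0 := fun a => by
          have := (Finset.sum_eq_zero_iff_of_nonneg
            (fun j _ => mul_nonneg (hG _ _) (hw j).le)).1 hz.symm a (Finset.mem_univ a)
          exact (mul_eq_zero.1 this).resolve_right (hw a).ne'
        have hzero : ∀ a b, stateHessian c act w d (act i s) a b = 0 := fun a b => by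
          have h1 := hrow i a
          rw [hHi a, mul_zero] at h1
          have := (Finset.sum_eq_zero_iff_of_nonneg
            (fun j _ => mul_nonneg (hG _ _) (hw j).le)).1 h1 b (Finset.mem_univ b)
          exact (mul_eq_zero.1 this).resolve_right (hw b).ne'
        simp [dotProduct, mulVec, hzero]
      · have := ih (act i s) v
        rw [hvw, hvw] at this
        rw [← mul_div_assoc, le_div_iff₀ hp]
        refine le_of_mul_le_mul_left ?_ hd
        linarith

end Trickle

section RankOne

open Matrix

theorem reverseCauchy_vecMulVec_sub {V K : Type*} [Fintype V] [Fintype K] (l : V → ℝ)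
    (P : Matrix K V ℝ) {w : V → ℝ} (hw : 0 ≤ w ⬝ᵥ (vecMulVec l l - Pᵀ * P) *ᵥ w) :
    ReverseCauchy (vecMulVec l l - Pᵀ * P) w := by
  have hform : ∀ u v : V → ℝ, u ⬝ᵥ (vecMulVec l l - Pᵀ * P) *ᵥ v =
      (l ⬝ᵥ u) * (l ⬝ᵥ v) - ∑ C, (P *ᵥ u) C * (P *ᵥ v) C := by
    intro u v
    rw [sub_mulVec, dotProduct_sub, ← mulVec_mulVec, dotProduct_mulVec u Pᵀ, vecMul_transpose]
    congr 1
    simp only [dotProduct, mulVec, vecMulVec_apply, Finset.mul_sum, Finset.sum_mul]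
    rw [Finset.sum_comm]
    exact Finset.sum_congr rfl fun i _ => Finset.sum_congr rfl fun j _ => by ring
  intro v
  rw [hform] at hw
  rw [hform, hform, hform]
  have hcs := Finset.sum_mul_sq_le_sq_mul_sq Finset.univ (P *ᵥ v) (P *ᵥ w)
  simp only [← sq] at hw ⊢
  have hp : 0 ≤ ∑ C, (P *ᵥ v) C ^ 2 := Finset.sum_nonneg fun _ _ => sq_nonneg _
  have hq : 0 ≤ ∑ C, (P *ᵥ w) C ^ 2 := Finset.sum_nonneg fun _ _ => sq_nonneg _
  generalize ∑ C, (P *ᵥ v) C ^ 2 = p at *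
  generalize ∑ C, (P *ᵥ w) C ^ 2 = q at *
  generalize ∑ C, (P *ᵥ v) C * (P *ᵥ w) C = r at *
  generalize l ⬝ᵥ v = a at *
  generalize l ⬝ᵥ w = b at *
  rcases hq.eq_or_lt with rfl | hq
  · have hr : r = 0 := by
      rw [mul_zero] at hcs
      exact (pow_eq_zero_iff two_ne_zero).1 (le_antisymm hcs (sq_nonneg r))
    subst hr
    nlinarith [mul_nonneg hp (sq_nonneg b)]
  · refine le_of_mul_le_mul_left ?_ hq
    nlinarith [mul_nonneg (sub_nonneg.2 hcs) hw, sq_nonneg (q * a - b * r)]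

end RankOne

section Matroid

open Matrix

variable {n : ℕ} {rk : Finset (Fin n) → ℕ}

theorem IsMatroidRank.insert_le (hrk : IsMatroidRank n rk) (i : Fin n) (S : Finset (Fin n)) :
    rk (insert i S) ≤ rk S + 1 := by
  have h1 := hrk.2.2 S {i}
  have h2 := hrk.1 {i}
  have h3 : S ∪ {i} = insert i S := by ext; simp
  rw [h3] at h1
  simp only [Finset.card_singleton] at h2
  omega

/-- Elements parallel after contracting `S` form an equivalence relation. -/
theorem IsMatroidRank.parallel_trans (hrk : IsMatroidRank n rk) {S : Finset (Fin n)} {r : ℕ}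
    {i j k : Fin n} (hj : r ≤ rk (insert j S)) (hij : rk (insert i (insert j S)) ≤ r)
    (hjk : rk (insert j (insert k S)) ≤ r) : rk (insert i (insert k S)) ≤ r := by
  have h1 := hrk.2.2 (insert i (insert j S)) (insert j (insert k S))
  have h2 := hrk.2.1 (insert j S) (insert i (insert j S) ∩ insert j (insert k S)) (by
    intro x; simp only [Finset.mem_inter, Finset.mem_insert]; tauto)
  have h3 := hrk.2.1 (insert i (insert k S)) (insert i (insert j S) ∪ insert j (insert k S)) (by
    intro x; simp only [Finset.mem_union, Finset.mem_insert]; tauto)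
  omega

/-- Adds an element of the matroid, or the homogenizing variable `none`, to a set;
the outer `none` records that an element was repeated. -/
def addElement (n : ℕ) : Option (Fin n) → Option (Finset (Fin n)) → Option (Finset (Fin n))
  | none, s => s
  | some _, none => none
  | some i, some S => if i ∈ S then none else some (insert i S)

/-- The indicator function of the independent sets. -/
noncomputable def indepIndicator (n : ℕ) (rk : Finset (Fin n) → ℕ) :
    Option (Finset (Fin n)) → ℝ
  | none => 0
  | some S => if rk S = S.card then 1 else 0

theorem addElement_comm (a b : Option (Fin n)) (s : Option (Finset (Fin n))) :
    addElement n a (addElement n b s) = addElement n b (addElement n a s) := by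
  rcases a with _ | i <;> rcases b with _ | j <;> rcases s with _ | S <;>
    simp only [addElement]
  by_cases hi : i ∈ S <;> by_cases hj : j ∈ S <;> by_cases hij : i = j <;>
    simp [hi, hj, hij, Finset.insert_comm, eq_comm]

theorem indepIndicator_nonneg (s : Option (Finset (Fin n))) : 0 ≤ indepIndicator n rk s := by
  rcases s with _ | S
  · exact le_rfl
  · simp only [indepIndicator]; split_ifs <;> norm_num

theorem indepIndicator_addElement (hrk : IsMatroidRank n rk) (a : Option (Fin n))
    (s : Option (Finset (Fin n))) (hs : indepIndicator n rk s = 0) :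
    indepIndicator n rk (addElement n a s) = 0 := by
  rcases a with _ | i <;> rcases s with _ | S <;> simp only [addElement] at * <;> try exact hs
  by_cases hi : i ∈ S
  · simp [hi, indepIndicator]
  · simp only [indepIndicator, ite_eq_right_iff, one_ne_zero, imp_false, hi, if_false,
      Finset.card_insert_of_notMem, not_false_eq_true] at *
    have := hrk.insert_le i S
    have := hrk.1 S
    omega

theorem reverseCauchy_indepIndicator (hrk : IsMatroidRank n rk) {w : Option (Fin n) → ℝ}
    (hw : ∀ a, 0 < w a) (s : Option (Finset (Fin n))) :
    ReverseCauchy (stateHessian (indepIndicator n rk) (addElement n) w 0 s) w := by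
  by_cases hs : indepIndicator n rk s = 0
  · have : stateHessian (indepIndicator n rk) (addElement n) w 0 s = 0 := by
      ext a b
      exact indepIndicator_addElement hrk _ _ (indepIndicator_addElement hrk _ _ hs)
    intro v
    simp [this]
  rcases s with _ | S
  · exact absurd rfl hs
  have hS : rk S = S.card := by simpa [indepIndicator] using hs
  set L : Finset (Fin n) := {i | i ∉ S ∧ rk (insert i S) = S.card + 1} with hL
  set R : Fin n → Finset (Fin n) :=
    fun i => {j ∈ L | rk (insert i (insert j S)) ≤ S.card + 1} with hR
  set l : Option (Fin n) → ℝ := fun a => a.elim 1 fun i => if i ∈ L then 1 else 0 with hl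
  set P : Matrix (Finset (Fin n)) (Option (Fin n)) ℝ :=
    Matrix.of fun C a => a.elim 0 fun i => if i ∈ L ∧ R i = C then 1 else 0 with hP
  have hRiff : ∀ i ∈ L, ∀ j ∈ L, (R i = R j ↔ rk (insert i (insert j S)) ≤ S.card + 1) := by
    intro i hi j hj
    have hi' := (Finset.mem_filter.1 hi).2.2
    have hj' := (Finset.mem_filter.1 hj).2.2
    constructor
    · intro h
      have : j ∈ R j := by simp [hR, hj, hj']
      rw [← h] at this
      exact (Finset.mem_filter.1 this).2
    · intro h
      ext k
      simp only [hR, Finset.mem_filter, and_congr_right_iff]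
      intro _
      constructor
      · intro hk
        exact hrk.parallel_trans hi'.ge (by rwa [Finset.insert_comm]) hk
      · intro hk
        exact hrk.parallel_trans hj'.ge h hk
  have hPP : ∀ i j, (Pᵀ * P) (some i) (some j) = if i ∈ L ∧ j ∈ L ∧ R i = R j then 1 else 0 := by
    intro i j
    rw [Matrix.mul_apply]
    simp only [hP, transpose_apply, of_apply, Option.elim_some]
    rw [Finset.sum_eq_single (R i)]
    · by_cases hi : i ∈ L <;> by_cases hj : j ∈ L <;> by_cases hij : R i = R j <;>
        simp [hi, hj, hij, eq_comm]
    · intro C _ hC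
      simp [hC.symm]
    · simp
  have hsing : ∀ i, indepIndicator n rk (addElement n (some i) (some S)) =
      if i ∈ L then 1 else 0 := by
    intro i
    by_cases hi : i ∈ S
    · simp [addElement, indepIndicator, hi, hL]
    · simp [addElement, indepIndicator, hi, hL]
  have hH : stateHessian (indepIndicator n rk) (addElement n) w 0 (some S) =
      vecMulVec l l - Pᵀ * P := by
    ext a b
    change indepIndicator n rk (addElement n a (addElement n b (some S))) = _
    rw [Matrix.sub_apply, vecMulVec_apply]
    rcases a with _ | i
    · have h0 : (Pᵀ * P) none b = 0 := by simp [Matrix.mul_apply, hP]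
      rw [h0]
      rcases b with _ | j
      · simp [addElement, indepIndicator, hS, hl]
      · exact (hsing j).trans (by simp [hl])
    · rcases b with _ | j
      · have h0 : (Pᵀ * P) (some i) none = 0 := by simp [Matrix.mul_apply, hP]
        rw [h0]
        exact (hsing i).trans (by simp [hl])
      · rw [hPP]
        by_cases hj : j ∈ L
        · by_cases hi : i ∈ L
          · have hi' := (Finset.mem_filter.1 hi).2
            have hj' := (Finset.mem_filter.1 hj).2
            have := hrk.insert_le i (insert j S)
            by_cases hij : i = j
            · subst hij
              simp [addElement, indepIndicator, hi', hl, hi]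
            · have hcard : (insert i (insert j S)).card = S.card + 2 := by
                rw [Finset.card_insert_of_notMem (by simp [hij, hi'.1]),
                  Finset.card_insert_of_notMem hj'.1]
              have hiff := hRiff i hi j hj
              simp only [addElement, hj'.1, if_false, Finset.mem_insert, hij, hi'.1, or_self,
                indepIndicator, hcard, hl, Option.elim_some, hi, hj, if_true, true_and, hiff]
              by_cases hr : rk (insert i (insert j S)) ≤ S.card + 1
              · rw [if_neg (by omega), if_pos hr]; norm_num
              · rw [if_pos (by omega), if_neg hr]; norm_num
          · have h1 := hsing i
            rw [if_neg hi] at h1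
            rw [addElement_comm, indepIndicator_addElement hrk _ _ h1]
            simp [hl, hi]
        · have h1 := hsing j
          rw [if_neg hj] at h1
          rw [indepIndicator_addElement hrk _ _ h1]
          simp [hl, hj]
  have hentry : ∀ a b, 0 ≤ stateHessian (indepIndicator n rk) (addElement n) w 0 (some S) a b :=
    fun a b => indepIndicator_nonneg _
  have hnn : 0 ≤ w ⬝ᵥ stateHessian (indepIndicator n rk) (addElement n) w 0 (some S) *ᵥ w := by
    simp only [dotProduct, mulVec]
    exact Finset.sum_nonneg fun a _ => mul_nonneg (hw a).le <| Finset.sum_nonneg fun b _ =>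
      mul_nonneg (hentry a b) (hw b).le
  rw [hH] at hnn ⊢
  exact reverseCauchy_vecMulVec_sub l P hnn

theorem sum_powersetCard_sum_insert (m : ℕ) (f : Finset (Fin n) → ℝ) :
    ∑ S ∈ Finset.powersetCard m Finset.univ, ∑ i, (if i ∈ S then 0 else f (insert i S)) =
      (m + 1) * ∑ T ∈ Finset.powersetCard (m + 1) Finset.univ, f T := by
  have h1 : (m + 1) * ∑ T ∈ Finset.powersetCard (m + 1) Finset.univ, f T =
      ∑ T ∈ Finset.powersetCard (m + 1) Finset.univ, ∑ _i ∈ T, f T := by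
    rw [Finset.mul_sum]
    refine Finset.sum_congr rfl fun T hT => ?_
    rw [Finset.sum_const, (Finset.mem_powersetCard.1 hT).2, nsmul_eq_mul]
    push_cast; rfl
  have h2 : ∀ S : Finset (Fin n), ∑ i, (if i ∈ S then 0 else f (insert i S)) =
      ∑ i ∈ Sᶜ, f (insert i S) := by
    intro S
    rw [← Finset.sum_filter_not_add_sum_filter Finset.univ (· ∈ S)]
    rw [Finset.sum_eq_zero (s := Finset.univ.filter (· ∈ S)) (by
      intro i hi; rw [if_pos (Finset.mem_filter.1 hi).2]), add_zero]
    refine Finset.sum_congr (by ext; simp) fun i hi => if_neg (by simpa using hi)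
  rw [h1, Finset.sum_congr rfl fun S _ => h2 S, Finset.sum_sigma', Finset.sum_sigma']
  refine Finset.sum_bij' (fun x _ => ⟨insert x.2 x.1, x.2⟩) (fun x _ => ⟨x.1.erase x.2, x.2⟩)
    ?_ ?_ ?_ ?_ ?_
  · rintro ⟨S, i⟩ h
    simp only [Finset.mem_sigma, Finset.mem_powersetCard, Finset.mem_compl] at h ⊢
    simp [Finset.card_insert_of_notMem h.2, h.1.2]
  · rintro ⟨S, i⟩ h
    simp only [Finset.mem_sigma, Finset.mem_powersetCard, Finset.mem_compl] at h ⊢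
    simp [Finset.card_erase_of_mem h.2, h.1.2]
  · rintro ⟨S, i⟩ h
    simp only [Finset.mem_sigma, Finset.mem_compl] at h
    simp [Finset.erase_insert h.2]
  · rintro ⟨S, i⟩ h
    simp only [Finset.mem_sigma] at h
    simp [Finset.insert_erase h.2]
  · intros; rfl

/-- The weight giving `t` to the homogenizing variable and `1` to every element. -/
def homogWeight (n : ℕ) (t : ℝ) : Option (Fin n) → ℝ := fun a => a.elim t fun _ => 1

theorem sum_stateSum_powersetCard (hrk : IsMatroidRank n rk) (d m : ℕ) :
    ∑ S ∈ Finset.powersetCard m Finset.univ,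
      stateSum (indepIndicator n rk) (addElement n) (homogWeight n 0) d (some S) =
      (m + d).choose d * Ik n rk (m + d) := by
  induction d generalizing m with
  | zero =>
    simp only [stateSum, indepIndicator, add_zero, Nat.choose_zero_right, Nat.cast_one, one_mul,
      Ik, Finset.card_filter]
    push_cast
    rfl
  | succ d ih =>
    have h1 : ∀ S : Finset (Fin n),
        stateSum (indepIndicator n rk) (addElement n) (homogWeight n 0) (d + 1) (some S) =
        (∑ i, (if i ∈ S then 0 else stateSum (indepIndicator n rk) (addElement n)
          (homogWeight n 0) d (some (insert i S)))) / (d + 1) := by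
      intro S
      rw [stateSum, Fintype.sum_option]
      simp only [homogWeight, Option.elim_none, Option.elim_some, zero_mul, zero_add, one_mul]
      congr 1
      refine Finset.sum_congr rfl fun i _ => ?_
      by_cases hi : i ∈ S
      · simp only [addElement, hi, if_true]
        exact stateSum_eq_zero (indepIndicator_addElement hrk) d rfl
      · simp [addElement, hi]
    rw [Finset.sum_congr rfl fun S _ => h1 S, ← Finset.sum_div,
      sum_powersetCard_sum_insert m fun T => stateSum (indepIndicator n rk) (addElement n)
          (homogWeight n 0) d (some T), ih (m + 1)]
    have h2 : ((m : ℝ) + 1) * (m + 1 + d).choose d = (m + (d + 1)).choose (d + 1) * (d + 1) := by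
      have h := Nat.choose_succ_right_eq (m + (d + 1)) d
      rw [show m + (d + 1) - d = m + 1 by omega] at h
      rw [show m + 1 + d = m + (d + 1) by omega]
      have h' : ((((m + (d + 1)).choose (d + 1) * (d + 1) : ℕ)) : ℝ) =
        (((m + (d + 1)).choose d * (m + 1) : ℕ) : ℝ) := by rw [h]
      push_cast at h'
      linarith
    rw [← mul_assoc, h2, show m + 1 + d = m + (d + 1) by omega]
    field_simp

theorem stateSum_empty_eq_Ik (hrk : IsMatroidRank n rk) (d : ℕ) :
    stateSum (indepIndicator n rk) (addElement n) (homogWeight n 0) d (some ∅) = Ik n rk d := by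
  simpa using sum_stateSum_powersetCard hrk d 0

theorem continuous_stateSum (d : ℕ) (s : Option (Finset (Fin n))) :
    Continuous fun t => stateSum (indepIndicator n rk) (addElement n) (homogWeight n t) d s := by
  induction d generalizing s with
  | zero => exact continuous_const
  | succ d ih =>
    simp only [stateSum]
    refine Continuous.div_const (continuous_finsetSum _ fun a _ => Continuous.mul ?_ (ih _)) _
    rcases a with _ | i
    · exact continuous_id
    · exact continuous_const

theorem stateSum_logConcave (hrk : IsMatroidRank n rk) (d : ℕ) {t : ℝ} (ht : 0 < t) :
    stateSum (indepIndicator n rk) (addElement n) (homogWeight n t) d (some ∅) *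
      ((d + 1) * ((d + 2) *
        stateSum (indepIndicator n rk) (addElement n) (homogWeight n t) (d + 2) (some ∅))) ≤
      ((d + 1) *
        stateSum (indepIndicator n rk) (addElement n) (homogWeight n t) (d + 1) (some ∅)) ^ 2 := by
  have hw : ∀ a, 0 < homogWeight n t a := by
    rintro (_ | i)
    · exact ht
    · exact one_pos
  have h := reverseCauchy_stateHessian (c := indepIndicator n rk) addElement_comm
    indepIndicator_nonneg hw (indepIndicator_addElement hrk) none (fun s hs => hs)
    (reverseCauchy_indepIndicator hrk hw) d (some ∅) (Pi.single none 1)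
  set w := homogWeight n t
  have hrow : ∀ a, (stateHessian (indepIndicator n rk) (addElement n) w d (some ∅) *ᵥ w) a =
      (d + 1) * stateSum (indepIndicator n rk) (addElement n) w (d + 1)
        (addElement n a (some ∅)) := by
    intro a
    rw [← sum_mul_stateSum]
    simp only [mulVec, dotProduct, stateHessian, of_apply]
    refine Finset.sum_congr rfl fun b _ => ?_
    rw [addElement_comm, mul_comm]
  have hww : w ⬝ᵥ stateHessian (indepIndicator n rk) (addElement n) w d (some ∅) *ᵥ w =
      (d + 1) * ((d + 2) * stateSum (indepIndicator n rk) (addElement n) w (d + 2) (some ∅)) := by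
    have := sum_mul_stateSum (c := indepIndicator n rk) (act := addElement n) (w := w) (d + 1)
      (some ∅)
    push_cast at this
    rw [show (d : ℝ) + 2 = d + 1 + 1 by ring, ← this, dotProduct, Finset.mul_sum]
    refine Finset.sum_congr rfl fun a _ => ?_
    rw [hrow]; ring
  rw [hww, single_one_dotProduct, single_one_dotProduct, hrow] at h
  simpa [stateHessian, addElement] using h

theorem Ik_logConcave (hrk : IsMatroidRank n rk) (d : ℕ) :
    (Ik n rk d : ℝ) * ((d + 1) * ((d + 2) * Ik n rk (d + 2))) ≤
      ((d + 1) * Ik n rk (d + 1)) ^ 2 := by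
  simp only [← stateSum_empty_eq_Ik hrk]
  have hcont := fun e => continuous_stateSum (rk := rk) e (some ∅)
  refine le_of_tendsto_of_tendsto (b := nhdsWithin 0 (Set.Ioi 0))
    (Continuous.tendsto (((hcont d).mul (((hcont (d + 2)).const_mul _).const_mul _))) 0
      |>.mono_left nhdsWithin_le_nhds)
    (Continuous.tendsto (((hcont (d + 1)).const_mul _).pow 2) 0
      |>.mono_left nhdsWithin_le_nhds)
    (eventually_nhdsWithin_of_forall fun t ht => stateSum_logConcave hrk d ht)

end Matroid

theorem statement14 (n : ℕ) (hn : 2 ≤ n) (rk : Finset (Fin n) → ℕ)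
    (hrk : IsMatroidRank n rk) (k : ℕ) (hk0 : 0 < k) :
    (((k : ℝ) + 1) / (k : ℝ)) * (Ik n rk (k-1) : ℝ) * (Ik n rk (k+1) : ℝ) ≤
      ((Ik n rk k : ℝ)) ^ 2 := by
  obtain ⟨d, rfl⟩ := Nat.exists_eq_succ_of_ne_zero hk0.ne'
  have h := Ik_logConcave hrk d
  have hd : (0 : ℝ) < d + 1 := by positivity
  simp only [Nat.succ_eq_add_one, Nat.add_sub_cancel]
  push_cast
  rw [div_mul_eq_mul_div, div_mul_eq_mul_div, div_le_iff₀ hd]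
  refine le_of_mul_le_mul_left ?_ hd
  linarith
end

section
/- Let n ≥ 2, let M be a matroid on [n], and let ℓ be the number of rank-one flats of M. Then for every 0 < m < n and every w ∈ ℝ^n with all coordinates nonnegative, f^m_M(w)² · C(ℓ,m+1) · C(ℓ,m−1) ≥ C(ℓ,m)² · f^{m+1}_M(w) · f^{m−1}_M(w), where C(a,b) denotes the binomial coefficient. (This is at least as strong as the inequality with ℓ replaced by n, since C(ℓ,m)²/(C(ℓ,m+1)C(ℓ,m−1)) ≥ C(n,m)²/(C(n,m+1)C(n,m−1)) when ℓ ≤ n.) -/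
open Finset

open scoped Matrix

theorem Matrix.IsSymm.dotProduct_mulVec_comm {ι : Type*} [Fintype ι] {H : Matrix ι ι ℝ}
    (hH : H.IsSymm) (v w : ι → ℝ) : v ⬝ᵥ H *ᵥ w = w ⬝ᵥ H *ᵥ v := by
  rw [Matrix.dotProduct_mulVec, ← Matrix.mulVec_transpose, hH.eq, dotProduct_comm]

theorem Matrix.IsSymm.dotProduct_mulVec_nonpos {ι : Type*} [Fintype ι]
    {S : Matrix ι ι ℝ} (hS : S.IsSymm) (y : ι → ℝ)
    (hy : ∀ (e : ι → ℝ) (c : ℝ), 0 < c → S *ᵥ e = c • e → y ⬝ᵥ e = 0) :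
    y ⬝ᵥ S *ᵥ y ≤ 0 := by
  classical
  have hA : S.IsHermitian := by
    rw [Matrix.IsHermitian, Matrix.conjTranspose_eq_transpose_of_trivial]
    exact hS
  have key := hA.eigenvectorBasis.sum_inner_mul_inner (WithLp.toLp 2 y) (WithLp.toLp 2 (S *ᵥ y))
  simp only [EuclideanSpace.inner_eq_star_dotProduct, star_trivial] at key
  rw [dotProduct_comm, ← key]
  refine Finset.sum_nonpos fun k _ => ?_
  have hk := hA.mulVec_eigenvectorBasis k
  rw [dotProduct_comm (S *ᵥ y), hS.dotProduct_mulVec_comm, hk, dotProduct_smul,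
    dotProduct_comm _ y]
  rcases le_or_gt (hA.eigenvalues k) 0 with h | h
  · simp only [smul_eq_mul]
    nlinarith [mul_self_nonneg (y ⬝ᵥ (hA.eigenvectorBasis k).ofLp)]
  · rw [hy _ _ h hk]
    simp

theorem Matrix.nonpos_on_ker_of_bochner {ι : Type*} [Fintype ι] {H : Matrix ι ι ℝ}
    (hH : H.IsSymm) (hnn : ∀ i j, 0 ≤ H i j) {w : ι → ℝ} (hw : ∀ i, 0 < w i) (o : ι)
    (ho : ∀ i, 0 < H i o ∨ ∀ j, H i j = 0)
    (hB : ∀ v, v ⬝ᵥ H *ᵥ v ≤ ∑ i, w i * ((H *ᵥ v) i ^ 2 / (H *ᵥ w) i))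
    {z : ι → ℝ} (hz : z ⬝ᵥ H *ᵥ w = 0) : z ⬝ᵥ H *ᵥ z ≤ 0 := by
  classical
  have hrow : ∀ i, (∀ j, H i j = 0) → ∀ v, (H *ᵥ v) i = 0 := fun i hi v => by
    simp [Matrix.mulVec, dotProduct, hi]
  have hpos : ∀ i, 0 < H i o → 0 < (H *ᵥ w) i := fun i hi =>
    Finset.sum_pos' (fun j _ => mul_nonneg (hnn i j) (hw j).le)
      ⟨o, Finset.mem_univ _, mul_pos hi (hw o)⟩
  set d : ι → ℝ := fun i => if 0 < H i o then √(w i / (H *ᵥ w) i) else 1 with hd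
  have hd0 : ∀ i, 0 < d i := fun i => by
    simp only [hd]
    split_ifs with h
    · exact Real.sqrt_pos.2 (div_pos (hw i) (hpos i h))
    · exact one_pos
  have hd2 : ∀ i, 0 < H i o → d i ^ 2 = w i / (H *ᵥ w) i := fun i h => by
    simp only [hd, h, if_true]
    exact Real.sq_sqrt (div_pos (hw i) (hpos i h)).le
  let S : Matrix ι ι ℝ := Matrix.of fun i j => d i * H i j * d j
  have hSv : ∀ e, S *ᵥ e = fun i => d i * (H *ᵥ (fun j => d j * e j)) i := fun e => by
    ext i
    simp only [S, Matrix.mulVec, dotProduct, Matrix.of_apply, Finset.mul_sum]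
    exact Finset.sum_congr rfl fun j _ => by ring
  have hS : S.IsSymm := by
    ext i j
    simp only [S, Matrix.transpose_apply, Matrix.of_apply, hH.apply i j]
    ring
  have hzy : (fun j => d j * (z j / d j)) = z := by
    ext j
    field_simp [(hd0 j).ne']
  have := hS.dotProduct_mulVec_nonpos (fun i => z i / d i) fun e c hc he => ?_
  · rw [hSv, hzy] at this
    refine le_trans (le_of_eq ?_) this
    exact Finset.sum_congr rfl fun i _ => by field_simp [(hd0 i).ne']
  set v : ι → ℝ := fun j => d j * e j with hv
  have hei : ∀ i, d i * (H *ᵥ v) i = c * e i := fun i => by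
    have := congrFun he i
    rw [hSv] at this
    exact this
  have hvv : v ⬝ᵥ H *ᵥ v = c * ∑ i, e i ^ 2 := by
    simp only [dotProduct, Finset.mul_sum]
    refine Finset.sum_congr rfl fun i _ => ?_
    calc v i * (H *ᵥ v) i = e i * (d i * (H *ᵥ v) i) := by simp only [hv]; ring
      _ = _ := by rw [hei]; ring
  have hE : ∑ i, e i ^ 2 ≤ c * ∑ i, e i ^ 2 := by
    have h1 : ∑ i, w i * ((H *ᵥ v) i ^ 2 / (H *ᵥ w) i) ≤ c ^ 2 * ∑ i, e i ^ 2 := by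
      rw [Finset.mul_sum]
      refine Finset.sum_le_sum fun i _ => ?_
      rcases ho i with h | h
      · refine le_of_eq ?_
        rw [← mul_pow, ← hei, mul_pow, hd2 i h]
        ring
      · rw [hrow i h w, div_zero, mul_zero]
        positivity
    have h2 := (hB v).trans h1
    rw [hvv, sq, mul_assoc] at h2
    exact le_of_mul_le_mul_left h2 hc
  have hdir : ∑ i, ∑ j, H i j * (w i * w j * (v i / w i - v j / w j) ^ 2) ≤ 0 := by
    have hexp : ∑ i, ∑ j, H i j * (w i * w j * (v i / w i - v j / w j) ^ 2) =
        2 * ∑ i, v i ^ 2 / w i * (H *ᵥ w) i - 2 * (v ⬝ᵥ H *ᵥ v) := by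
      have hswap : ∑ i, ∑ j, v j ^ 2 / w j * (H i j * w i) =
          ∑ i, ∑ j, v i ^ 2 / w i * (H i j * w j) := by
        rw [Finset.sum_comm]
        exact Finset.sum_congr rfl fun i _ => Finset.sum_congr rfl fun j _ => by
          rw [hH.apply i j]
      rw [two_mul (∑ i, _)]
      simp only [Matrix.mulVec, dotProduct, Finset.mul_sum]
      nth_rewrite 2 [← hswap]
      simp only [← Finset.sum_add_distrib, ← Finset.sum_sub_distrib]
      refine Finset.sum_congr rfl fun i _ => Finset.sum_congr rfl fun j _ => ?_
      have hi := (hw i).ne'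
      have hj := (hw j).ne'
      field_simp
      ring
    rw [hexp, hvv]
    have : ∑ i, v i ^ 2 / w i * (H *ᵥ w) i ≤ ∑ i, e i ^ 2 := by
      refine Finset.sum_le_sum fun i _ => ?_
      rcases ho i with h | h
      · refine le_of_eq ?_
        have h1 := (hpos i h).ne'
        have h2 := (hw i).ne'
        simp only [hv, mul_pow, hd2 i h]
        field_simp
      · rw [hrow i h w, mul_zero]
        positivity
    linarith
  have hterm : ∀ i, 0 < H i o → v i = v o / w o * w i := fun i hi => by
    have hnn' : ∀ i j, 0 ≤ H i j * (w i * w j * (v i / w i - v j / w j) ^ 2) := fun i j =>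
      mul_nonneg (hnn i j) (mul_nonneg (mul_pos (hw i) (hw j)).le (sq_nonneg _))
    have h1 : H i o * (w i * w o * (v i / w i - v o / w o) ^ 2) ≤ 0 :=
      ((Finset.single_le_sum (fun j _ => hnn' i j) (Finset.mem_univ o)).trans
        (Finset.single_le_sum (f := fun i => ∑ j, H i j * (w i * w j * (v i / w i - v j / w j) ^ 2))
          (fun i _ => Finset.sum_nonneg fun j _ => hnn' i j) (Finset.mem_univ i))).trans hdir
    have h2 := le_antisymm h1 (hnn' i o)
    have h3 : v i / w i - v o / w o = 0 := by
      simpa [hi.ne', (hw i).ne', (hw o).ne'] using h2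
    rw [← sub_eq_zero.1 h3, div_mul_cancel₀ _ (hw i).ne']
  have hfin : c * ((fun i => z i / d i) ⬝ᵥ e) = 0 := by
    have h1 : c * ((fun i => z i / d i) ⬝ᵥ e) = z ⬝ᵥ H *ᵥ v := by
      simp only [dotProduct, Finset.mul_sum]
      refine Finset.sum_congr rfl fun i _ => ?_
      rw [mul_left_comm, ← hei]
      field_simp [(hd0 i).ne']
    have h2 : v ⬝ᵥ H *ᵥ z = v o / w o * (w ⬝ᵥ H *ᵥ z) := by
      simp only [dotProduct, Finset.mul_sum]
      refine Finset.sum_congr rfl fun i _ => ?_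
      rcases ho i with h | h
      · rw [hterm i h, mul_assoc]
      · rw [hrow i h z]
        ring
    rw [h1, hH.dotProduct_mulVec_comm, h2, hH.dotProduct_mulVec_comm, hz, mul_zero]
  exact (mul_eq_zero.1 hfin).resolve_left hc.ne'
theorem Matrix.mul_le_sq_of_nonpos_on_ker {ι : Type*} [Fintype ι] {H : Matrix ι ι ℝ}
    (hH : H.IsSymm) (L : (ι → ℝ) →ₗ[ℝ] ℝ) (hL : ∀ v, L v = 0 → v ⬝ᵥ H *ᵥ v ≤ 0)
    {w : ι → ℝ} (hw : 0 ≤ w ⬝ᵥ H *ᵥ w) (v : ι → ℝ) :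
    (v ⬝ᵥ H *ᵥ v) * (w ⬝ᵥ H *ᵥ w) ≤ (v ⬝ᵥ H *ᵥ w) ^ 2 := by
  have hsymm : w ⬝ᵥ H *ᵥ v = v ⬝ᵥ H *ᵥ w :=
    hH.dotProduct_mulVec_comm w v
  by_cases h0 : L w = 0
  · have : w ⬝ᵥ H *ᵥ w = 0 := le_antisymm (hL w h0) hw
    rw [this, mul_zero]
    positivity
  · set t := L v / L w with ht
    have hz := hL (v - t • w) (by simp [ht, h0])
    have hexp : (v - t • w) ⬝ᵥ H *ᵥ (v - t • w) =
        v ⬝ᵥ H *ᵥ v - 2 * t * (v ⬝ᵥ H *ᵥ w) + t ^ 2 * (w ⬝ᵥ H *ᵥ w) := by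
      simp only [Matrix.mulVec_sub, Matrix.mulVec_smul, sub_dotProduct, dotProduct_sub,
        smul_dotProduct, dotProduct_smul, smul_eq_mul, hsymm]
      ring
    rw [hexp] at hz
    nlinarith [mul_nonneg hw (neg_nonneg.2 hz), sq_nonneg (v ⬝ᵥ H *ᵥ w - t * (w ⬝ᵥ H *ᵥ w))]

namespace MvPolynomial

theorem pderiv_comm {σ R : Type*} [CommRing R] (i j : σ) (f : MvPolynomial σ R) :
    pderiv i (pderiv j f) = pderiv j (pderiv i f) := by
  classical
  have h : ⁅(pderiv i : Derivation R (MvPolynomial σ R) (MvPolynomial σ R)),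
      (pderiv j : Derivation R (MvPolynomial σ R) (MvPolynomial σ R))⁆ = 0 := by
    refine derivation_ext fun k => ?_
    simp [Derivation.commutator_apply, pderiv_X, Pi.single_apply, apply_ite]
  have := congrArg (fun D : Derivation R (MvPolynomial σ R) (MvPolynomial σ R) => D f) h
  simpa [Derivation.commutator_apply, sub_eq_zero] using this

/-- The Hessian matrix of a polynomial at a point. -/
noncomputable def hessian {σ : Type*} (f : MvPolynomial σ ℝ) (w : σ → ℝ) : Matrix σ σ ℝ :=
  Matrix.of fun i j => eval w (pderiv i (pderiv j f))

theorem hessian_isSymm {σ : Type*} (f : MvPolynomial σ ℝ) (w : σ → ℝ) : (hessian f w).IsSymm := by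
  ext i j
  simp [hessian, pderiv_comm i j]

theorem IsHomogeneous.sum_mul_eval_pderiv {σ : Type*} [Fintype σ] {f : MvPolynomial σ ℝ} {k : ℕ}
    (hf : f.IsHomogeneous k) (w : σ → ℝ) : ∑ i, w i * eval w (pderiv i f) = k * eval w f := by
  have := congrArg (eval w) hf.sum_X_mul_pderiv
  simpa using this

theorem IsHomogeneous.hessian_mulVec_self {σ : Type*} [Fintype σ] {f : MvPolynomial σ ℝ} {k : ℕ}
    (hf : f.IsHomogeneous (k + 1)) (w : σ → ℝ) (i : σ) :
    (hessian f w *ᵥ w) i = k * eval w (pderiv i f) := by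
  have := (hf.pderiv (i := i)).sum_mul_eval_pderiv w
  rw [Nat.add_sub_cancel] at this
  rw [← this]
  exact Finset.sum_congr rfl fun j _ => by simp [hessian, pderiv_comm i j, mul_comm]

theorem IsHomogeneous.hessian_pderiv_mulVec {σ : Type*} [Fintype σ] {f : MvPolynomial σ ℝ} {k : ℕ}
    (hf : f.IsHomogeneous (k + 2)) (v w : σ → ℝ) (i : σ) :
    v ⬝ᵥ hessian (pderiv i f) w *ᵥ w = k * (hessian f w *ᵥ v) i := by
  simp only [dotProduct, Matrix.mulVec, Finset.mul_sum]
  refine Finset.sum_congr rfl fun j _ => ?_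
  have := (hf.pderiv (i := i)).hessian_mulVec_self w j
  rw [Matrix.mulVec, dotProduct] at this
  rw [← Finset.mul_sum, this, hessian, Matrix.of_apply, pderiv_comm i j]
  ring

theorem IsHomogeneous.sum_mul_hessian_pderiv {σ : Type*} [Fintype σ] {f : MvPolynomial σ ℝ} {k : ℕ}
    (hf : f.IsHomogeneous (k + 2)) (v w : σ → ℝ) :
    ∑ i, w i * (v ⬝ᵥ hessian (pderiv i f) w *ᵥ v) = k * (v ⬝ᵥ hessian f w *ᵥ v) := by
  simp only [dotProduct, Matrix.mulVec, Finset.mul_sum]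
  rw [Finset.sum_comm]
  refine Finset.sum_congr rfl fun j _ => ?_
  rw [Finset.sum_comm]
  refine Finset.sum_congr rfl fun l _ => ?_
  have := ((hf.pderiv (i := l)).pderiv (i := j)).sum_mul_eval_pderiv w
  simp only [hessian, Matrix.of_apply]
  calc _ = v j * v l * ∑ i, w i * eval w (pderiv i (pderiv j (pderiv l f))) := by
        rw [Finset.mul_sum]
        refine Finset.sum_congr rfl fun i _ => ?_
        rw [pderiv_comm l i, pderiv_comm j i]
        ring
    _ = _ := by
        rw [this]
        simp only [Nat.add_one_sub_one]
        ring

theorem IsHomogeneous.hessian_mul_le_sq {σ : Type*} [Fintype σ] {f : MvPolynomial σ ℝ} {k : ℕ}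
    (hk : 0 < k) (hf : f.IsHomogeneous (k + 2)) {w : σ → ℝ} (hw : ∀ i, 0 < w i)
    (hnn : ∀ i j, 0 ≤ hessian f w i j) (o : σ)
    (ho : ∀ i, 0 < hessian f w i o ∨ pderiv i f = 0)
    (hder : ∀ i v, (v ⬝ᵥ hessian (pderiv i f) w *ᵥ v) * (w ⬝ᵥ hessian (pderiv i f) w *ᵥ w) ≤
      (v ⬝ᵥ hessian (pderiv i f) w *ᵥ w) ^ 2) (v : σ → ℝ) :
    (v ⬝ᵥ hessian f w *ᵥ v) * (w ⬝ᵥ hessian f w *ᵥ w) ≤ (v ⬝ᵥ hessian f w *ᵥ w) ^ 2 := by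
  have hk' : (0 : ℝ) < k := by exact_mod_cast hk
  have hsymm := hessian_isSymm f w
  refine Matrix.mul_le_sq_of_nonpos_on_ker hsymm (Fintype.linearCombination ℝ (hessian f w *ᵥ w))
    (fun z hz => Matrix.nonpos_on_ker_of_bochner hsymm hnn hw o ?_ ?_ hz) ?_ v
  · refine fun i => (ho i).imp id fun h j => ?_
    simp [hessian, pderiv_comm i j, h]
  · intro u
    refine le_of_mul_le_mul_left ?_ hk'
    rw [← hf.sum_mul_hessian_pderiv u w, Finset.mul_sum]
    refine Finset.sum_le_sum fun i _ => ?_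
    rcases ho i with h | h
    · have hpos : 0 < (hessian f w *ᵥ w) i :=
        Finset.sum_pos' (fun j _ => mul_nonneg (hnn i j) (hw j).le)
          ⟨o, Finset.mem_univ _, mul_pos h (hw o)⟩
      have h1 := hder i u
      rw [hf.hessian_pderiv_mulVec, hf.hessian_pderiv_mulVec] at h1
      rw [mul_left_comm]
      refine mul_le_mul_of_nonneg_left ?_ (hw i).le
      rw [mul_div_assoc', le_div_iff₀ hpos]
      refine le_of_mul_le_mul_left ?_ hk'
      linarith
    · have h0 : ∀ u, (hessian f w *ᵥ u) i = 0 := fun u => by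
        simp [hessian, Matrix.mulVec, dotProduct, pderiv_comm i, h]
      rw [h0 u, h]
      simp [hessian, Matrix.mulVec, dotProduct]
  · exact Finset.sum_nonneg fun i _ => mul_nonneg (hw i).le
      (Finset.sum_nonneg fun j _ => mul_nonneg (hnn i j) (hw j).le)

end MvPolynomial

namespace IsMatroidRank

variable {n : ℕ} {rk : Finset (Fin n) → ℕ}

theorem indep_subset_s15 (hrk : IsMatroidRank n rk) {A B : Finset (Fin n)} (hBA : B ⊆ A)
    (hA : rk A = #A) : rk B = #B := by
  have h1 := hrk.2.2 B (A \ B)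
  rw [Finset.union_sdiff_of_subset hBA] at h1
  have h2 := hrk.1 (A \ B)
  have h3 := Finset.card_sdiff_add_card_eq_card hBA
  have h4 := hrk.1 B
  omega

theorem rk_insert_eq_of_subset (hrk : IsMatroidRank n rk) {A B : Finset (Fin n)} (hAB : A ⊆ B)
    {j : Fin n} (hj : rk (insert j A) = rk A) : rk (insert j B) = rk B := by
  have h1 := hrk.2.2 (insert j A) B
  have h2 : insert j A ∪ B = insert j B := by
    rw [Finset.insert_union, Finset.union_eq_right.2 hAB]
  have h3 := hrk.2.1 A (insert j A ∩ B)
    (Finset.subset_inter (Finset.subset_insert _ _) hAB)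
  have h4 := hrk.2.1 B (insert j B) (Finset.subset_insert _ _)
  rw [h2] at h1
  omega

/-- The closure of a set: the elements whose addition does not increase the rank. -/
def closure (rk : Finset (Fin n) → ℕ) (A : Finset (Fin n)) : Finset (Fin n) :=
  Finset.univ.filter fun j => rk (insert j A) = rk A

theorem mem_closure {A : Finset (Fin n)} {j : Fin n} :
    j ∈ closure rk A ↔ rk (insert j A) = rk A := by
  simp [closure]

theorem subset_closure (A : Finset (Fin n)) : A ⊆ closure rk A := fun j hj => by
  rw [mem_closure, Finset.insert_eq_of_mem hj]

theorem rk_union_eq (hrk : IsMatroidRank n rk) {A : Finset (Fin n)} (B : Finset (Fin n))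
    (hB : ∀ j ∈ B, rk (insert j A) = rk A) : rk (A ∪ B) = rk A := by
  induction B using Finset.induction_on with
  | empty => simp
  | insert b B _ ih =>
    rw [Finset.union_insert, hrk.rk_insert_eq_of_subset Finset.subset_union_left
      (hB b (Finset.mem_insert_self _ _))]
    exact ih fun j hj => hB j (Finset.mem_insert_of_mem hj)

theorem rk_closure (hrk : IsMatroidRank n rk) (A : Finset (Fin n)) : rk (closure rk A) = rk A := by
  rw [← hrk.rk_union_eq (closure rk A) fun j hj => mem_closure.1 hj,
    Finset.union_eq_right.2 (subset_closure A)]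

theorem rk_closure_lt (hrk : IsMatroidRank n rk) (A : Finset (Fin n)) {j : Fin n}
    (hj : j ∉ closure rk A) : rk (closure rk A) < rk (insert j (closure rk A)) := by
  rw [hrk.rk_closure]
  have h1 := hrk.2.1 _ _ (Finset.insert_subset_insert j (subset_closure (rk := rk) A))
  have h2 := hrk.2.1 _ _ (Finset.subset_insert j A)
  rw [mem_closure] at hj
  omega

theorem closure_insert_eq (hrk : IsMatroidRank n rk) {J : Finset (Fin n)} {i j : Fin n}
    (hij : rk (insert i J) = rk (insert j J))
    (h : rk (insert j (insert i J)) = rk (insert i J)) :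
    closure rk (insert i J) = closure rk (insert j J) := by
  have aux : ∀ i j, rk (insert i J) = rk (insert j J) →
      rk (insert j (insert i J)) = rk (insert i J) →
      closure rk (insert i J) ⊆ closure rk (insert j J) := by
    intro i j hij h x hx
    rw [mem_closure] at hx ⊢
    have h1 := hrk.rk_insert_eq_of_subset (Finset.subset_insert j _) hx
    have h2 := hrk.2.1 (insert x (insert j J)) (insert x (insert j (insert i J)))
      (Finset.insert_subset_insert _ (Finset.insert_subset_insert _ (Finset.subset_insert _ _)))
    have h3 := hrk.2.1 _ _ (Finset.subset_insert x (insert j J))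
    omega
  exact (aux i j hij h).antisymm (aux j i hij.symm (by rw [Finset.insert_comm, h, hij]))

/-- A set whose subsets of size at most two are independent has at most as many elements as there
are rank-one flats. -/
theorem card_le_card_flats (hrk : IsMatroidRank n rk) {T : Finset (Fin n)}
    (hT : ∀ i ∈ T, ∀ j ∈ T, rk {i, j} = #{i, j}) :
    #T ≤ Nat.card {F : Finset (Fin n) // (∀ j ∉ F, rk F < rk (insert j F)) ∧ rk F = 1} := by
  classical
  rw [Nat.card_eq_fintype_card, Fintype.card_subtype]
  refine Finset.card_le_card_of_injOn (fun i => closure rk {i}) (fun i hi => ?_)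
    fun i hi j hj hij => ?_
  · simp only [Finset.coe_filter, Finset.mem_univ, true_and, Set.mem_ofPred_eq]
    refine ⟨fun j hj => hrk.rk_closure_lt _ hj, ?_⟩
    rw [hrk.rk_closure]
    simpa using hT i hi i hi
  · by_contra hne
    have h1 : j ∈ closure rk {i} := by
      have := subset_closure (rk := rk) {j} (Finset.mem_singleton_self j)
      rwa [← show closure rk {i} = closure rk {j} from hij] at this
    rw [mem_closure, Finset.pair_comm, hT i hi j hj, Finset.card_pair hne] at h1
    have h2 := hT i hi i hi
    simp only [Finset.pair_eq_singleton, Finset.card_singleton] at h2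
    omega

/-- The elements extending `J` to an independent set. -/
def extensions (rk : Finset (Fin n) → ℕ) (J : Finset (Fin n)) : Finset (Fin n) :=
  Finset.univ.filter fun i => i ∉ J ∧ rk (insert i J) = #(insert i J)

theorem mem_extensions {J : Finset (Fin n)} {i : Fin n} :
    i ∈ extensions rk J ↔ i ∉ J ∧ rk (insert i J) = #(insert i J) := by
  simp [extensions]

theorem indep_insert_insert_iff (hrk : IsMatroidRank n rk) {J : Finset (Fin n)} {i j : Fin n}
    (hi : i ∈ extensions rk J) (hj : j ∈ extensions rk J) :
    (j ∉ insert i J ∧ rk (insert j (insert i J)) = #(insert j (insert i J))) ↔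
      closure rk (insert i J) ≠ closure rk (insert j J) := by
  rw [mem_extensions] at hi hj
  have ci := Finset.card_insert_of_notMem hi.1
  have cj := Finset.card_insert_of_notMem hj.1
  constructor
  · rintro ⟨h1, h2⟩ heq
    have h3 : j ∈ closure rk (insert i J) := by
      rw [heq]
      exact subset_closure _ (Finset.mem_insert_self _ _)
    rw [mem_closure, h2, Finset.card_insert_of_notMem h1] at h3
    omega
  · intro hne
    have h1 : j ∉ insert i J := by
      rw [Finset.mem_insert, not_or]
      refine ⟨?_, hj.1⟩
      rintro rfl
      exact hne rfl
    refine ⟨h1, ?_⟩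
    have h2 := mt (hrk.closure_insert_eq (J := J) (i := i) (j := j) (by omega)) hne
    have h3 := hrk.1 (insert j (insert i J))
    have h4 := hrk.2.1 _ _ (Finset.subset_insert j (insert i J))
    rw [Finset.card_insert_of_notMem h1] at h3 ⊢
    omega

theorem card_add_card_classes_le (hrk : IsMatroidRank n rk) {J : Finset (Fin n)}
    (hJ : rk J = #J) :
    #J + #((extensions rk J).image fun i => closure rk (insert i J)) ≤
      Nat.card {F : Finset (Fin n) // (∀ j ∉ F, rk F < rk (insert j F)) ∧ rk F = 1} := by
  classical
  set c : Fin n → Finset (Fin n) := fun i => closure rk (insert i J)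
  obtain ⟨R, hR, himg, hinj⟩ : ∃ R ⊆ extensions rk J, R.image c = (extensions rk J).image c ∧
      Set.InjOn c R := by
    obtain ⟨R, hR, hbij⟩ := Set.SurjOn.exists_bijOn_subset
      (Set.surjOn_image c (extensions rk J : Set (Fin n)))
    have hfin : R.Finite := Set.toFinite R
    refine ⟨hfin.toFinset, fun x hx => hR (hfin.mem_toFinset.1 hx), ?_, ?_⟩
    · rw [← Finset.coe_inj]
      simpa using hbij.image_eq
    · simpa using hbij.injOn
  rw [← himg, Finset.card_image_of_injOn hinj, ← Finset.card_union_of_disjoint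
    (Finset.disjoint_left.2 fun x hx hxR => (mem_extensions.1 (hR hxR)).1 hx)]
  refine hrk.card_le_card_flats fun i hi j hj => ?_
  have hone : ∀ r ∈ R, ∀ x ∈ J, rk {r, x} = #{r, x} := fun r hr x hx =>
    hrk.indep_subset_s15 (Finset.insert_subset_insert r (Finset.singleton_subset_iff.2 hx))
      (mem_extensions.1 (hR hr)).2
  rcases Finset.mem_union.1 hi with hi | hi <;> rcases Finset.mem_union.1 hj with hj | hj
  · exact hrk.indep_subset_s15 (by simp [Finset.insert_subset_iff, hi, hj]) hJ
  · rw [Finset.pair_comm]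
    exact hone j hj i hi
  · exact hone i hi j hj
  · by_cases hij : i = j
    · subst hij
      exact hrk.indep_subset_s15 (by simp) (mem_extensions.1 (hR hi)).2
    · refine hrk.indep_subset_s15 ?_ ((hrk.indep_insert_insert_iff (hR hi) (hR hj)).2
        fun h => hij (hinj hi hj h)).2
      simp [Finset.insert_subset_iff]

end IsMatroidRank

namespace IsMatroidRank

open MvPolynomial

variable {n : ℕ} {rk : Finset (Fin n) → ℕ} {ℓ : ℕ}

theorem pderiv_none_prod (s : Finset (Fin n)) :
    pderiv none (∏ k ∈ s, X (some k) : MvPolynomial (Option (Fin n)) ℝ) = 0 := by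
  induction s using Finset.induction_on with
  | empty => simp
  | insert k s hk ih => simp [Finset.prod_insert hk, ih]

theorem pderiv_some_prod (i : Fin n) (s : Finset (Fin n)) :
    pderiv (some i) (∏ k ∈ s, X (some k) : MvPolynomial (Option (Fin n)) ℝ) =
      if i ∈ s then ∏ k ∈ s.erase i, X (some k) else 0 := by
  induction s using Finset.induction_on with
  | empty => simp
  | insert k s hk ih =>
    rw [Finset.prod_insert hk, pderiv_mul, ih]
    by_cases hik : k = i
    · subst hik
      simp [hk]
    · rw [pderiv_X_of_ne (by simpa using hik), Finset.erase_insert_of_ne hik]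
      by_cases his : i ∈ s
      · simp [his, Finset.prod_insert (fun h => hk (Finset.mem_of_mem_erase h))]
      · simp [his, Ne.symm hik]

/-- The result of differentiating `∑ x₀ ^ (ℓ - |I|) ∏_{i ∈ I} x i`, the sum being over all
independent sets `I`, once by each variable of `J` and `a` times by `x₀`. -/
noncomputable def genPoly (rk : Finset (Fin n) → ℕ) (ℓ : ℕ) (J : Finset (Fin n)) (a : ℕ) :
    MvPolynomial (Option (Fin n)) ℝ :=
  ∑ I ∈ Finset.univ.filter fun I => J ⊆ I ∧ rk I = #I,
    C ((ℓ - #I).descFactorial a : ℝ) * X none ^ (ℓ - #I - a) * ∏ i ∈ I \ J, X (some i)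

theorem pderiv_none_genPoly (J : Finset (Fin n)) (a : ℕ) :
    pderiv none (genPoly rk ℓ J a) = genPoly rk ℓ J (a + 1) := by
  rw [genPoly, genPoly, map_sum]
  refine Finset.sum_congr rfl fun I _ => ?_
  rw [pderiv_mul, pderiv_none_prod, mul_zero, add_zero, pderiv_C_mul, pderiv_pow, pderiv_X_self,
    Nat.descFactorial_succ, Nat.sub_sub (ℓ - #I)]
  simp only [Nat.cast_mul, map_mul, map_natCast, mul_one]
  ring

theorem pderiv_some_genPoly (J : Finset (Fin n)) (a : ℕ) (i : Fin n) :
    pderiv (some i) (genPoly rk ℓ J a) = if i ∈ J then 0 else genPoly rk ℓ (insert i J) a := by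
  have hterm : ∀ I : Finset (Fin n), pderiv (some i) (C ((ℓ - #I).descFactorial a : ℝ) *
      X none ^ (ℓ - #I - a) * ∏ i ∈ I \ J, X (some i)) =
      if i ∈ I \ J then C ((ℓ - #I).descFactorial a : ℝ) * X none ^ (ℓ - #I - a) *
        ∏ i ∈ I \ insert i J, X (some i) else 0 := fun I => by
    rw [pderiv_mul, pderiv_some_prod, pderiv_C_mul, pderiv_pow, pderiv_X_of_ne (by simp),
      Finset.sdiff_insert]
    split_ifs <;> simp
  rw [genPoly, map_sum, Finset.sum_congr rfl fun I _ => hterm I]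
  split_ifs with hi
  · simp [hi]
  · rw [genPoly, ← Finset.sum_filter, Finset.filter_filter]
    refine Finset.sum_congr ?_ fun _ _ => rfl
    ext I
    simp only [Finset.mem_filter, Finset.mem_univ, true_and, Finset.mem_sdiff,
      Finset.insert_subset_iff, hi, not_false_eq_true, and_true]
    tauto

theorem genPoly_eq_zero (hrk : IsMatroidRank n rk) {J : Finset (Fin n)} (hJ : rk J ≠ #J) (a : ℕ) :
    genPoly rk ℓ J a = 0 := by
  rw [genPoly, Finset.filter_false_of_mem, Finset.sum_empty]
  exact fun I _ h => hJ (hrk.indep_subset_s15 h.1 h.2)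

theorem genPoly_isHomogeneous (hle : ∀ I, rk I = #I → #I ≤ ℓ) {J : Finset (Fin n)} {a r : ℕ}
    (hr : #J + a + r = ℓ) : (genPoly rk ℓ J a).IsHomogeneous r := by
  refine IsHomogeneous.sum _ _ _ fun I hI => ?_
  simp only [Finset.mem_filter, Finset.mem_univ, true_and] at hI
  rcases lt_or_ge (ℓ - #I) a with h | h
  · rw [Nat.descFactorial_eq_zero_iff_lt.2 h]
    simpa using isHomogeneous_zero _ _ _
  · have h1 : (∏ i ∈ I \ J, X (some i) : MvPolynomial (Option (Fin n)) ℝ).IsHomogeneous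
        (∑ _i ∈ I \ J, 1) := IsHomogeneous.prod _ _ _ fun i _ => isHomogeneous_X _ _
    have h2 := ((isHomogeneous_C (Option (Fin n)) ((ℓ - #I).descFactorial a : ℝ)).mul
      (isHomogeneous_X_pow (R := ℝ) (none : Option (Fin n)) (ℓ - #I - a))).mul h1
    convert h2 using 1
    have h3 := Finset.card_sdiff_add_card_eq_card hI.1
    have h4 := hle I hI.2
    rw [Finset.sum_const, smul_eq_mul, mul_one]
    omega

theorem eval_genPoly (w : Option (Fin n) → ℝ) (J : Finset (Fin n)) (a : ℕ) :
    eval w (genPoly rk ℓ J a) = ∑ I ∈ Finset.univ.filter fun I => J ⊆ I ∧ rk I = #I,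
      ((ℓ - #I).descFactorial a : ℝ) * w none ^ (ℓ - #I - a) * ∏ i ∈ I \ J, w (some i) := by
  simp [genPoly]

theorem eval_genPoly_nonneg {w : Option (Fin n) → ℝ} (hw : ∀ i, 0 < w i) (J : Finset (Fin n))
    (a : ℕ) : 0 ≤ eval w (genPoly rk ℓ J a) := by
  rw [eval_genPoly]
  exact Finset.sum_nonneg fun I _ => mul_nonneg (mul_nonneg (Nat.cast_nonneg _)
    (pow_nonneg (hw _).le _)) (Finset.prod_nonneg fun i _ => (hw _).le)

theorem eval_genPoly_pos {w : Option (Fin n) → ℝ} (hw : ∀ i, 0 < w i) {J : Finset (Fin n)}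
    (hJ : rk J = #J) {a : ℕ} (ha : #J + a ≤ ℓ) : 0 < eval w (genPoly rk ℓ J a) := by
  rw [eval_genPoly]
  refine Finset.sum_pos' (fun I _ => mul_nonneg (mul_nonneg (Nat.cast_nonneg _)
    (pow_nonneg (hw _).le _)) (Finset.prod_nonneg fun i _ => (hw _).le)) ⟨J, by simp [hJ], ?_⟩
  have : 0 < (ℓ - #J).descFactorial a := Nat.pos_of_ne_zero fun h => by
    rw [Nat.descFactorial_eq_zero_iff_lt] at h
    omega
  simpa using mul_pos (Nat.cast_pos.2 this) (pow_pos (hw none) _)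

theorem eval_genPoly_of_card_add_eq (hrk : IsMatroidRank n rk)
    (hle : ∀ I, rk I = #I → #I ≤ ℓ) (w : Option (Fin n) → ℝ) {J : Finset (Fin n)} {a : ℕ} (ha : #J + a = ℓ) :
    eval w (genPoly rk ℓ J a) = if rk J = #J then (a.factorial : ℝ) else 0 := by
  split_ifs with hJ
  · rw [eval_genPoly, Finset.sum_eq_single_of_mem J (by simp [hJ])]
    · have : ℓ - #J = a := by omega
      simp [this, Nat.descFactorial_self]
    · intro I hI hne
      simp only [Finset.mem_filter, Finset.mem_univ, true_and] at hI
      have := Finset.card_lt_card (hI.1.ssubset_of_ne hne.symm)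
      have := hle I hI.2
      rw [Nat.descFactorial_eq_zero_iff_lt.2 (by omega)]
      simp
  · simp [hrk.genPoly_eq_zero hJ]

theorem hessian_genPoly_none_none (w : Option (Fin n) → ℝ) (J : Finset (Fin n)) (a : ℕ) :
    hessian (genPoly rk ℓ J a) w none none = eval w (genPoly rk ℓ J (a + 2)) := by
  simp [hessian, pderiv_none_genPoly]

theorem hessian_genPoly_some_none (w : Option (Fin n) → ℝ) (J : Finset (Fin n)) (a : ℕ)
    (i : Fin n) : hessian (genPoly rk ℓ J a) w (some i) none =
      if i ∈ J then 0 else eval w (genPoly rk ℓ (insert i J) (a + 1)) := by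
  simp only [hessian, Matrix.of_apply, pderiv_none_genPoly, pderiv_some_genPoly]
  split_ifs <;> simp

theorem hessian_genPoly_some_some (w : Option (Fin n) → ℝ) (J : Finset (Fin n)) (a : ℕ)
    (i j : Fin n) : hessian (genPoly rk ℓ J a) w (some j) (some i) =
      if i ∈ J then 0 else if j ∈ insert i J then 0 else
        eval w (genPoly rk ℓ (insert j (insert i J)) a) := by
  simp only [hessian, Matrix.of_apply, pderiv_some_genPoly]
  split_ifs with h1 h2 <;> simp_all [pderiv_some_genPoly]

end IsMatroidRank

namespace IsMatroidRank

open MvPolynomial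

variable {n : ℕ} {rk : Finset (Fin n) → ℕ} {ℓ : ℕ}

theorem sum_sum_ite_eq {ι κ : Type*} [DecidableEq κ] (s : Finset ι) (c : ι → κ) (y : ι → ℝ) :
    ∑ i ∈ s, ∑ j ∈ s, (if c i = c j then y i * y j else 0) =
      ∑ k ∈ s.image c, (∑ i ∈ s with c i = k, y i) ^ 2 := by
  rw [← Finset.sum_fiberwise_of_maps_to fun i hi => Finset.mem_image_of_mem c hi]
  refine Finset.sum_congr rfl fun k _ => ?_
  rw [sq, Finset.sum_mul]
  refine Finset.sum_congr rfl fun i hi => ?_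
  rw [← Finset.sum_filter, Finset.mul_sum]
  refine Finset.sum_congr ?_ fun _ _ => rfl
  rw [(Finset.mem_filter.1 hi).2]
  exact Finset.filter_congr fun j _ => eq_comm

theorem quadratic_genPoly (hrk : IsMatroidRank n rk) (hle : ∀ I, rk I = #I → #I ≤ ℓ)
    {J : Finset (Fin n)} (hJ : rk J = #J) {a : ℕ} (ha : #J + a + 2 = ℓ)
    (w v : Option (Fin n) → ℝ) :
    v ⬝ᵥ hessian (genPoly rk ℓ J a) w *ᵥ v = a.factorial * ((a + 2) * (a + 1) * v none ^ 2 +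
      2 * (a + 1) * v none * (∑ i ∈ extensions rk J, v (some i)) +
      (∑ i ∈ extensions rk J, v (some i)) ^ 2 -
      ∑ k ∈ (extensions rk J).image fun i => closure rk (insert i J),
        (∑ i ∈ extensions rk J with closure rk (insert i J) = k, v (some i)) ^ 2) := by
  classical
  have h00 : hessian (genPoly rk ℓ J a) w none none = a.factorial * ((a + 2) * (a + 1)) := by
    rw [hessian_genPoly_none_none, hrk.eval_genPoly_of_card_add_eq hle w (by omega), if_pos hJ]
    simp only [Nat.factorial_succ]
    push_cast
    ring
  have hi0 : ∀ i, hessian (genPoly rk ℓ J a) w (some i) none =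
      if i ∈ extensions rk J then a.factorial * (a + 1 : ℝ) else 0 := fun i => by
    rw [hessian_genPoly_some_none]
    by_cases hi : i ∈ J
    · simp [hi, mem_extensions]
    · have hc := Finset.card_insert_of_notMem hi
      rw [hrk.eval_genPoly_of_card_add_eq hle w (by omega), if_neg hi]
      simp only [mem_extensions, hi, not_false_eq_true, true_and, Nat.factorial_succ]
      push_cast
      simp only [mul_comm]
  have hij : ∀ i j, hessian (genPoly rk ℓ J a) w (some i) (some j) =
      if i ∈ extensions rk J then if j ∈ extensions rk J then
        if closure rk (insert i J) = closure rk (insert j J) then 0 else (a.factorial : ℝ)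
        else 0 else 0 := fun i j => by
    rw [(hessian_isSymm _ w).apply (some i) (some j) |>.symm, hessian_genPoly_some_some]
    by_cases hi : i ∈ extensions rk J
    · by_cases hj : j ∈ extensions rk J
      · rw [if_neg (mem_extensions.1 hi).1, if_pos hi, if_pos hj]
        have key := hrk.indep_insert_insert_iff hi hj
        by_cases hji : j ∈ insert i J
        · rw [if_pos hji, if_pos]
          by_contra hne
          exact (key.2 hne).1 hji
        · have hc := Finset.card_insert_of_notMem hji
          have hc' := Finset.card_insert_of_notMem (mem_extensions.1 hi).1
          rw [hrk.eval_genPoly_of_card_add_eq hle w (by omega), if_neg hji]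
          by_cases h : rk (insert j (insert i J)) = #(insert j (insert i J))
          · rw [if_pos h, if_neg (key.1 ⟨hji, h⟩)]
          · rw [if_neg h, if_pos]
            by_contra hne
            exact h (key.2 hne).2
      · rw [if_pos hi, if_neg hj]
        by_cases hji : j ∈ insert i J
        · simp [hji]
        · rw [hrk.genPoly_eq_zero]
          · simp
          · intro h
            refine hj (mem_extensions.2 ⟨fun h' => hji (Finset.mem_insert_of_mem h'), ?_⟩)
            exact hrk.indep_subset_s15 (Finset.insert_subset_insert j (Finset.subset_insert i J)) h
    · rw [if_neg hi]
      by_cases hiJ : i ∈ J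
      · simp [hiJ]
      · rw [hrk.genPoly_eq_zero]
        · simp
        · intro h
          exact hi (mem_extensions.2 ⟨hiJ, hrk.indep_subset_s15 (Finset.subset_insert j _) h⟩)
  have h0i : ∀ i, hessian (genPoly rk ℓ J a) w none (some i) =
      if i ∈ extensions rk J then a.factorial * (a + 1 : ℝ) else 0 := fun i => by
    rw [← hi0, (hessian_isSymm _ w).apply]
  rw [← sum_sum_ite_eq, sq (∑ i ∈ extensions rk J, v (some i)), Finset.sum_mul_sum]
  rw [add_sub_assoc, ← Finset.sum_sub_distrib]
  simp only [← Finset.sum_sub_distrib]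
  simp only [dotProduct, Matrix.mulVec, Fintype.sum_option, h00, hi0, h0i, hij]
  have hrow : ∑ j, (if j ∈ extensions rk J then a.factorial * (a + 1 : ℝ) else 0) * v (some j) =
      a.factorial * (a + 1) * ∑ j ∈ extensions rk J, v (some j) := by
    simp only [ite_mul, zero_mul, Finset.sum_ite_mem, Finset.univ_inter, Finset.mul_sum]
  have hblock : ∀ i, v (some i) * ((if i ∈ extensions rk J then a.factorial * (a + 1 : ℝ) else 0) *
      v none + ∑ j, (if i ∈ extensions rk J then if j ∈ extensions rk J then
        if closure rk (insert i J) = closure rk (insert j J) then 0 else (a.factorial : ℝ)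
        else 0 else 0) * v (some j)) = if i ∈ extensions rk J then
      a.factorial * (a + 1) * v none * v (some i) + a.factorial *
        ∑ j ∈ extensions rk J, (v (some i) * v (some j) -
          if closure rk (insert i J) = closure rk (insert j J) then v (some i) * v (some j) else 0)
      else 0 := fun i => by
    split_ifs with hi
    · rw [mul_add, Finset.mul_sum, Finset.mul_sum]
      congr 1
      · ring
      · simp only [ite_mul, mul_ite, zero_mul, mul_zero, Finset.sum_ite_mem, Finset.univ_inter]
        refine Finset.sum_congr rfl fun j _ => ?_
        split_ifs <;> ring
    · simp
  rw [hrow, Finset.sum_congr rfl fun i _ => hblock i, Finset.sum_ite_mem, Finset.univ_inter,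
    Finset.sum_add_distrib, ← Finset.mul_sum, ← Finset.mul_sum]
  ring

theorem hessian_genPoly_mul_le_sq (hrk : IsMatroidRank n rk)
    (hℓ : ∀ J, rk J = #J →
      #J + #((extensions rk J).image fun i => closure rk (insert i J)) ≤ ℓ)
    {w : Option (Fin n) → ℝ} (hw : ∀ i, 0 < w i) (k : ℕ) :
    ∀ (J : Finset (Fin n)) (a : ℕ), #J + a + (k + 2) = ℓ → ∀ v,
      (v ⬝ᵥ hessian (genPoly rk ℓ J a) w *ᵥ v) * (w ⬝ᵥ hessian (genPoly rk ℓ J a) w *ᵥ w) ≤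
        (v ⬝ᵥ hessian (genPoly rk ℓ J a) w *ᵥ w) ^ 2 := by
  have hle : ∀ I, rk I = #I → #I ≤ ℓ := fun I hI => le_of_add_le_left (hℓ I hI)
  have hzero : ∀ (f : MvPolynomial (Option (Fin n)) ℝ), f = 0 → ∀ v,
      (v ⬝ᵥ hessian f w *ᵥ v) * (w ⬝ᵥ hessian f w *ᵥ w) ≤ (v ⬝ᵥ hessian f w *ᵥ w) ^ 2 := by
    rintro f rfl v
    simp [hessian, dotProduct, Matrix.mulVec]
  have hnn : ∀ (J : Finset (Fin n)) (a : ℕ) (i j : Option (Fin n)),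
      0 ≤ hessian (genPoly rk ℓ J a) w i j := by
    intro J a i j
    rcases i with _ | i <;> rcases j with _ | j
    · rw [hessian_genPoly_none_none]
      exact eval_genPoly_nonneg hw _ _
    · rw [← (hessian_isSymm _ w).apply, hessian_genPoly_some_none]
      split_ifs
      exacts [le_rfl, eval_genPoly_nonneg hw _ _]
    · rw [hessian_genPoly_some_none]
      split_ifs
      exacts [le_rfl, eval_genPoly_nonneg hw _ _]
    · rw [hessian_genPoly_some_some]
      split_ifs
      exacts [le_rfl, le_rfl, eval_genPoly_nonneg hw _ _]
  induction k with
  | zero =>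
    intro J a ha v
    by_cases hJ : rk J = #J
    · refine Matrix.mul_le_sq_of_nonpos_on_ker (hessian_isSymm _ w)
        ((a + 2 : ℝ) • LinearMap.proj none +
          ∑ i ∈ extensions rk J, LinearMap.proj (some i)) (fun u hu => ?_)
        (Finset.sum_nonneg fun i _ => mul_nonneg (hw i).le
          (Finset.sum_nonneg fun j _ => mul_nonneg (hnn J a i j) (hw j).le)) v
      have hu' : ∑ i ∈ extensions rk J, u (some i) = - ((a + 2) * u none) := by
        simp at hu
        linarith
      rw [hrk.quadratic_genPoly hle hJ (by omega)]
      refine mul_nonpos_of_nonneg_of_nonpos (Nat.cast_nonneg _) ?_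
      have hcs := sq_sum_le_card_mul_sum_sq
        (s := (extensions rk J).image fun i => closure rk (insert i J))
        (f := fun k => ∑ i ∈ extensions rk J with closure rk (insert i J) = k, u (some i))
      rw [Finset.sum_fiberwise_of_maps_to fun i hi => Finset.mem_image_of_mem _ hi, hu'] at hcs
      have hcard : (#((extensions rk J).image fun i => closure rk (insert i J)) : ℝ) ≤ a + 2 := by
        have := hℓ J hJ
        exact_mod_cast (by omega :
          #((extensions rk J).image fun i => closure rk (insert i J)) ≤ a + 2)
      set Q := ∑ k ∈ (extensions rk J).image fun i => closure rk (insert i J),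
        (∑ i ∈ extensions rk J with closure rk (insert i J) = k, u (some i)) ^ 2
      have hQ : 0 ≤ Q := Finset.sum_nonneg fun _ _ => sq_nonneg _
      have ha2 : (0 : ℝ) < a + 2 := by positivity
      have h1 : (a + 2 : ℝ) * ((a + 2) * u none ^ 2) ≤ (a + 2) * Q := by
        nlinarith [mul_le_mul_of_nonneg_right hcard hQ]
      have h2 := le_of_mul_le_mul_left h1 ha2
      rw [hu']
      nlinarith
    · exact hzero _ (hrk.genPoly_eq_zero hJ a) v
  | succ k ih =>
    intro J a ha v
    by_cases hJ : rk J = #J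
    · refine (genPoly_isHomogeneous hle ha).hessian_mul_le_sq (k := k + 1) k.succ_pos hw (hnn J a)
        none ?_ ?_ v
      · rintro (_ | i)
        · left
          rw [hessian_genPoly_none_none]
          exact eval_genPoly_pos hw hJ (by omega)
        · rw [hessian_genPoly_some_none, pderiv_some_genPoly]
          by_cases hi : i ∈ J
          · simp [hi]
          · rw [if_neg hi, if_neg hi]
            by_cases hJi : rk (insert i J) = #(insert i J)
            · have := Finset.card_insert_of_notMem hi
              exact Or.inl (eval_genPoly_pos hw hJi (by omega))
            · exact Or.inr (hrk.genPoly_eq_zero hJi a)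
      · rintro (_ | i)
        · rw [pderiv_none_genPoly]
          exact ih J (a + 1) (by omega)
        · rw [pderiv_some_genPoly]
          split_ifs with hi
          · exact hzero _ rfl
          · have := Finset.card_insert_of_notMem hi
            exact ih (insert i J) a (by omega)
    · exact hzero _ (hrk.genPoly_eq_zero hJ a) v

theorem eval_genPoly_mul_le_sq (hrk : IsMatroidRank n rk)
    (hℓ : ∀ J, rk J = #J →
      #J + #((extensions rk J).image fun i => closure rk (insert i J)) ≤ ℓ)
    {w : Option (Fin n) → ℝ} (hw : ∀ i, 0 ≤ w i) {m a : ℕ} (hm : 0 < m) (ha : m + a + 1 = ℓ) :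
    (m + 1) * eval w (genPoly rk ℓ ∅ (a + 2)) * eval w (genPoly rk ℓ ∅ a) ≤
      m * eval w (genPoly rk ℓ ∅ (a + 1)) ^ 2 := by
  classical
  have hpos : ∀ u : Option (Fin n) → ℝ, (∀ i, 0 < u i) →
      (m + 1) * eval u (genPoly rk ℓ ∅ (a + 2)) * eval u (genPoly rk ℓ ∅ a) ≤
        m * eval u (genPoly rk ℓ ∅ (a + 1)) ^ 2 := by
    intro u hu
    obtain ⟨k, rfl⟩ : ∃ k, m = k + 1 := ⟨m - 1, by omega⟩
    have hle : ∀ I, rk I = #I → #I ≤ ℓ := fun I hI => le_of_add_le_left (hℓ I hI)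
    have hhom : (genPoly rk ℓ ∅ a).IsHomogeneous (k + 1 + 1) :=
      genPoly_isHomogeneous hle (by simp; omega)
    have key := hrk.hessian_genPoly_mul_le_sq hℓ hu k ∅ a (by simp; omega) (Pi.single none 1)
    have h1 : u ⬝ᵥ hessian (genPoly rk ℓ ∅ a) u *ᵥ u =
        ((k + 1 : ℕ) : ℝ) * (((k + 1 + 1 : ℕ) : ℝ) * eval u (genPoly rk ℓ ∅ a)) := by
      rw [← hhom.sum_mul_eval_pderiv, dotProduct, Finset.mul_sum]
      exact Finset.sum_congr rfl fun i _ => by rw [hhom.hessian_mulVec_self]; ring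
    rw [single_one_dotProduct, single_one_dotProduct, Matrix.mulVec_single_one, Matrix.col_apply,
      hessian_genPoly_none_none, hhom.hessian_mulVec_self, pderiv_none_genPoly, h1] at key
    refine le_of_mul_le_mul_left ?_ (show (0 : ℝ) < (k + 1 : ℕ) by positivity)
    refine le_trans (le_of_eq ?_) (key.trans (le_of_eq ?_)) <;> push_cast <;> ring
  have hlim : ∀ b, Filter.Tendsto (fun ε : ℝ => eval (fun i => w i + ε) (genPoly rk ℓ ∅ b))
      (nhdsWithin 0 (Set.Ioi 0)) (nhds (eval w (genPoly rk ℓ ∅ b))) := fun b => by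
    have hc : Continuous fun ε : ℝ => eval (fun i => w i + ε) (genPoly rk ℓ ∅ b) :=
      (continuous_eval _).comp (by fun_prop)
    have := (hc.tendsto 0).mono_left (nhdsWithin_le_nhds (s := Set.Ioi 0))
    simpa using this
  refine le_of_tendsto_of_tendsto (((hlim (a + 2)).const_mul _).mul (hlim a))
    (((hlim (a + 1)).pow 2).const_mul _) ?_
  filter_upwards [self_mem_nhdsWithin] with ε hε
  exact hpos _ fun i => add_pos_of_nonneg_of_pos (hw i) hε

theorem eval_genPoly_elim_zero (w : Fin n → ℝ) {m a : ℕ} (ha : m + a = ℓ)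
    (hle : ∀ I, rk I = #I → #I ≤ ℓ) :
    eval (fun i : Option (Fin n) => i.elim 0 w) (genPoly rk ℓ ∅ a) = a.factorial * fm n rk m w := by
  rw [eval_genPoly, fm, Finset.mul_sum]
  symm
  refine Finset.sum_subset_zero_on_sdiff (fun I hI => ?_) (fun I hI => ?_) fun I hI => ?_
  · simp only [Finset.mem_filter, Finset.mem_powersetCard] at hI
    simp [hI.2]
  · simp only [Finset.mem_filter, Finset.mem_powersetCard, Finset.mem_sdiff, Finset.mem_univ,
      true_and, Finset.empty_subset, Finset.subset_univ, not_and] at hI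
    have h1 := hle I hI.1
    have h2 : #I ≠ m := fun h => hI.2 h hI.1
    rcases lt_or_ge (ℓ - #I) a with h | h
    · rw [Nat.descFactorial_eq_zero_iff_lt.2 h]
      simp
    · simp [zero_pow (show ℓ - #I - a ≠ 0 by omega)]
  · simp only [Finset.mem_filter, Finset.mem_powersetCard] at hI
    have : ℓ - #I = a := by omega
    simp [this, Nat.descFactorial_self]

end IsMatroidRank

theorem statement15 (n : ℕ) (hn : 2 ≤ n) (rk : Finset (Fin n) → ℕ)
    (hrk : IsMatroidRank n rk) (ℓ : ℕ)
    -- `ℓ` is the number of rank-one flats of `M`, where a flat is a subset `F`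
    -- such that adding any element outside of `F` increases the rank:
    (hℓ : ℓ = Nat.card {F : Finset (Fin n) //
      (∀ j ∉ F, rk F < rk (insert j F)) ∧ rk F = 1})
    (m : ℕ) (hm0 : 0 < m) (hmn : m < n)
    (w : Fin n → ℝ) (hw : ∀ i, 0 ≤ w i) :
    ((ℓ.choose m : ℝ)) ^ 2 * fm n rk (m+1) w * fm n rk (m-1) w ≤
      (fm n rk m w) ^ 2 * (ℓ.choose (m+1) : ℝ) * (ℓ.choose (m-1) : ℝ) := by
  have hcl : ∀ J, rk J = #J →
      #J + #((IsMatroidRank.extensions rk J).image fun i =>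
        IsMatroidRank.closure rk (insert i J)) ≤ ℓ := fun J hJ =>
    (hrk.card_add_card_classes_le hJ).trans hℓ.ge
  have hle : ∀ I, rk I = #I → #I ≤ ℓ := fun I hI => le_of_add_le_left (hcl I hI)
  rcases lt_or_ge m ℓ with h | h
  · obtain ⟨a, ha⟩ : ∃ a, m + a + 1 = ℓ := ⟨ℓ - m - 1, by omega⟩
    obtain ⟨k, rfl⟩ : ∃ k, m = k + 1 := ⟨m - 1, by omega⟩
    have key := hrk.eval_genPoly_mul_le_sq hcl (w := fun i => i.elim 0 w)
      (by rintro (_ | i); exacts [le_rfl, hw i]) hm0 ha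
    rw [IsMatroidRank.eval_genPoly_elim_zero w (m := k) (by omega) hle,
      IsMatroidRank.eval_genPoly_elim_zero w (m := k + 1 + 1) (by omega) hle,
      IsMatroidRank.eval_genPoly_elim_zero w (m := k + 1) (by omega) hle] at key
    have c1 : (ℓ.choose (k + 1 + 1) : ℝ) * (k + 2) = ℓ.choose (k + 1) * (a + 1) := by
      have := Nat.choose_succ_right_eq ℓ (k + 1)
      rw [show ℓ - (k + 1) = a + 1 by omega] at this
      exact_mod_cast this
    have c2 : (ℓ.choose (k + 1) : ℝ) * (k + 1) = ℓ.choose k * (a + 2) := by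
      have := Nat.choose_succ_right_eq ℓ k
      rw [show ℓ - k = a + 2 by omega] at this
      exact_mod_cast this
    simp only [Nat.factorial_succ, Nat.add_sub_cancel] at key ⊢
    push_cast at key
    set x := fm n rk (k + 1 + 1) w
    set y := fm n rk (k + 1) w
    set z := fm n rk k w
    have hf : (0 : ℝ) < a.factorial ^ 2 * (a + 1) := by positivity
    have key' : (k + 2) * (a + 2) * z * x ≤ (k + 1) * (a + 1) * y ^ 2 := by
      refine le_of_mul_le_mul_left ?_ hf
      linarith
    have e1 : (ℓ.choose (k + 1 + 1) : ℝ) = ℓ.choose (k + 1) * (a + 1) / (k + 2) := by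
      rw [eq_div_iff (by positivity), c1]
    have e2 : (ℓ.choose k : ℝ) = ℓ.choose (k + 1) * (k + 1) / (a + 2) := by
      rw [eq_div_iff (by positivity), c2]
    rw [e1, e2]
    have hk : (0 : ℝ) < (k + 2) * (a + 2) := by positivity
    refine le_of_mul_le_mul_left ?_ hk
    have hmul := mul_le_mul_of_nonneg_left key' (sq_nonneg (ℓ.choose (k + 1) : ℝ))
    refine le_trans (le_of_eq ?_) (hmul.trans (le_of_eq ?_))
    · ring
    · field_simp
  · have hzero : fm n rk (m + 1) w = 0 := by
      rw [fm, Finset.filter_false_of_mem, Finset.sum_empty]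
      intro I hI hrkI
      have := hle I hrkI
      rw [(Finset.mem_powersetCard.1 hI).2] at this
      omega
    rw [hzero, mul_zero, zero_mul]
    positivity
end
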